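/- arXiv:2510.13335 — 13 statements merged into one kernel-verified Lean document; each statement's English description precedes it below -/
import Mathlib

section
/- Let (V₁,V₂,E) be a 2-layer graph with edge multiplicities μ, let k be a natural number, and let σ be a 2-layer drawing whose weighted number of crossings is at most k. Then for every natural number t and every subset S ⊆ E with Σ_{e∈S} μ(e) > 2·√k + t, the blue edges of S have total multiplicity at least t+1, i.e. Σ over blue edges e ∈ S of μ(e) is at least t+1. -/
open Finset
open scoped Classical

/-- Two edges of a 2-layer graph cross in the drawing `(σ₁, σ₂)`. -/
def Cross2 {V₁ V₂ : Type*} (σ₁ : V₁ → ℝ) (σ₂ : V₂ → ℝ) (e f : V₁ × V₂) : Prop :=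
  (σ₁ e.1 < σ₁ f.1 ∧ σ₂ f.2 < σ₂ e.2) ∨ (σ₁ f.1 < σ₁ e.1 ∧ σ₂ e.2 < σ₂ f.2)

/-- The weighted number of crossings of the drawing `(σ₁, σ₂)`: every unordered crossing
pair `{e, f}` of edges of `E` is counted exactly once, with weight `μ e * μ f` (the
one-sided order condition selects exactly one of the two orderings of a crossing pair). -/
noncomputable def wCrossNum {V₁ V₂ : Type*} (E : Finset (V₁ × V₂)) (μ : V₁ × V₂ → ℕ)
    (σ₁ : V₁ → ℝ) (σ₂ : V₂ → ℝ) : ℕ :=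
  ∑ p ∈ (E ×ˢ E).filter (fun p => σ₁ p.1.1 < σ₁ p.2.1 ∧ σ₂ p.2.2 < σ₂ p.1.2),
    μ p.1 * μ p.2

/-- The weighted crossing load of an edge `e`: the total multiplicity of the edges
of `E` crossing `e`. -/
noncomputable def wLoad {V₁ V₂ : Type*} (E : Finset (V₁ × V₂)) (μ : V₁ × V₂ → ℕ)
    (σ₁ : V₁ → ℝ) (σ₂ : V₂ → ℝ) (e : V₁ × V₂) : ℕ :=
  ∑ f ∈ E.filter (fun f => Cross2 σ₁ σ₂ e f), μ f

/-- An edge is blue if its weighted crossing load is at most `√k`. -/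
def Blue {V₁ V₂ : Type*} (E : Finset (V₁ × V₂)) (μ : V₁ × V₂ → ℕ)
    (σ₁ : V₁ → ℝ) (σ₂ : V₂ → ℝ) (k : ℕ) (e : V₁ × V₂) : Prop :=
  (wLoad E μ σ₁ σ₂ e : ℝ) ≤ Real.sqrt k

/-- Handshake identity: the loads of the edges, weighted by multiplicity, count every crossing
twice. -/
theorem sum_mul_wLoad {V₁ V₂ : Type*} (E : Finset (V₁ × V₂)) (μ : V₁ × V₂ → ℕ)
    (σ₁ : V₁ → ℝ) (σ₂ : V₂ → ℝ) :
    ∑ e ∈ E, μ e * wLoad E μ σ₁ σ₂ e = 2 * wCrossNum E μ σ₁ σ₂ := by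
  have h_cross : wCrossNum E μ σ₁ σ₂ =
      ∑ e ∈ E, ∑ f ∈ E, if σ₁ e.1 < σ₁ f.1 ∧ σ₂ f.2 < σ₂ e.2 then μ e * μ f else 0 := by
    rw [wCrossNum, sum_filter, sum_product]
  rw [two_mul]
  nth_rewrite 2 [h_cross]
  rw [sum_comm, h_cross, ← sum_add_distrib]
  refine sum_congr rfl fun e _ => ?_
  rw [wLoad, sum_filter, mul_sum, ← sum_add_distrib]
  refine sum_congr rfl fun f _ => ?_
  by_cases h₁ : σ₁ e.1 < σ₁ f.1 ∧ σ₂ f.2 < σ₂ e.2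
  · have h₂ : ¬(σ₁ f.1 < σ₁ e.1 ∧ σ₂ e.2 < σ₂ f.2) := fun h => lt_asymm h.1 h₁.1
    rw [if_pos (show Cross2 σ₁ σ₂ e f from Or.inl h₁), if_pos h₁, if_neg h₂, add_zero]
  · by_cases h₂ : σ₁ f.1 < σ₁ e.1 ∧ σ₂ e.2 < σ₂ f.2
    · rw [if_pos (show Cross2 σ₁ σ₂ e f from Or.inr h₂), if_neg h₁, if_pos h₂, zero_add, mul_comm]
    · rw [if_neg (show ¬Cross2 σ₁ σ₂ e f from not_or.2 ⟨h₁, h₂⟩),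
        if_neg h₁, if_neg h₂, mul_zero, add_zero]

/-- The edges that are not blue have total multiplicity at most `2√k`. -/
theorem sum_not_blue_le {V₁ V₂ : Type*} (E : Finset (V₁ × V₂)) (μ : V₁ × V₂ → ℕ)
    (hμ : ∀ e ∈ E, 1 ≤ μ e) (σ₁ : V₁ → ℝ) (σ₂ : V₂ → ℝ) (k : ℕ)
    (hcr : wCrossNum E μ σ₁ σ₂ ≤ k) (S : Finset (V₁ × V₂)) (hS : S ⊆ E) :
    ∑ e ∈ S with ¬Blue E μ σ₁ σ₂ k e, (μ e : ℝ) ≤ 2 * Real.sqrt k := by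
  by_contra! hlt
  set R := S.filter fun e => ¬Blue E μ σ₁ σ₂ k e
  have hRE : R ⊆ E := (filter_subset _ _).trans hS
  have hR : R.Nonempty := by
    refine nonempty_of_sum_ne_zero (f := fun e => (μ e : ℝ)) ?_
    exact ((mul_nonneg zero_le_two (Real.sqrt_nonneg k)).trans_lt hlt).ne'
  have h_load : ∑ e ∈ R, (μ e : ℝ) * Real.sqrt k < ∑ e ∈ R, (μ e : ℝ) * wLoad E μ σ₁ σ₂ e := by
    refine sum_lt_sum_of_nonempty hR fun e he => ?_
    exact mul_lt_mul_of_pos_left (not_le.1 (mem_filter.1 he).2)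
      (Nat.cast_pos.2 (hμ e (hRE he)))
  have h_total : ∑ e ∈ R, (μ e : ℝ) * wLoad E μ σ₁ σ₂ e ≤ 2 * k := by
    have h : ∑ e ∈ R, μ e * wLoad E μ σ₁ σ₂ e ≤ 2 * k :=
      (sum_le_sum_of_subset hRE).trans
        ((sum_mul_wLoad E μ σ₁ σ₂).trans_le (Nat.mul_le_mul_left 2 hcr))
    exact_mod_cast h
  rw [← sum_mul] at h_load
  nlinarith [Real.mul_self_sqrt (Nat.cast_nonneg (α := ℝ) k),
    mul_le_mul_of_nonneg_right hlt.le (Real.sqrt_nonneg k)]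

/-- If the weighted number of crossings is at most `k`, then any set `S ⊆ E` of total
multiplicity greater than `2√k + t` has blue edges of total multiplicity at least `t + 1`. -/
theorem blue_total_multiplicity {V₁ V₂ : Type*} [Fintype V₁] [Fintype V₂]
    (E : Finset (V₁ × V₂)) (μ : V₁ × V₂ → ℕ) (hμ : ∀ e ∈ E, 1 ≤ μ e)
    (σ₁ : V₁ → ℝ) (σ₂ : V₂ → ℝ)
    (hσ₁ : Function.Injective σ₁) (hσ₂ : Function.Injective σ₂)
    (k : ℕ) (hcr : wCrossNum E μ σ₁ σ₂ ≤ k)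
    (t : ℕ) (S : Finset (V₁ × V₂)) (hS : S ⊆ E)
    (hbig : 2 * Real.sqrt k + (t : ℝ) < ∑ e ∈ S, (μ e : ℝ)) :
    t + 1 ≤ ∑ e ∈ S.filter (fun e => Blue E μ σ₁ σ₂ k e), μ e := by
  have h_red := sum_not_blue_le E μ hμ σ₁ σ₂ k hcr S hS
  have h_split := sum_filter_add_sum_filter_not S (fun e => Blue E μ σ₁ σ₂ k e)
    (fun e => (μ e : ℝ))
  have h_blue : (t : ℝ) < ∑ e ∈ S.filter (fun e => Blue E μ σ₁ σ₂ k e), (μ e : ℝ) := by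
    linarith
  exact_mod_cast h_blue
end

section
/- (Separator Lemma for two layers.) Let k ≥ 1 be a natural number, let (V₁,V₂,E) be a 2-layer graph with edge multiplicities μ, and let σ be a 2-layer drawing whose weighted number of crossings equals k. Suppose there exist edges lb, rb ∈ E such that every edge e = (e₁,e₂) ∈ E satisfies σ₁(lb₁) ≤ σ₁(e₁) ≤ σ₁(rb₁) and σ₂(lb₂) ≤ σ₂(e₂) ≤ σ₂(rb₂). Then there exist distinct edges lsep, rsep ∈ E such that: (1) both lsep and rsep are blue; (2) σ₁(lsep₁) ≤ σ₁(rsep₁) and σ₂(lsep₂) ≤ σ₂(rsep₂) with at least one of these inequalities strict, and lsep and rsep do not cross; (3) the weighted number of crossing pairs {e,f} with both e and f to the left of lsep is at most k/2, and the weighted number of crossing pairs with both edges to the right of rsep is at most k/2, where an edge e is to the left of an edge g if σ₁(e₁) ≤ σ₁(g₁) and σ₂(e₂) ≤ σ₂(g₂) with at least one inequality strict, and to the right of g is defined symmetrically; (4) the total multiplicity of edges e ∉ {lsep,rsep} with σ₁(lsep₁) ≤ σ₁(e₁) ≤ σ₁(rsep₁) and σ₂(lsep₂) ≤ σ₂(e₂)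 ≤ σ₂(rsep₂) is at most 2·√k; (5) the total multiplicity of edges that cross lsep or cross rsep is at most 2·√k. -/
open Finset
open scoped Classical

/-- The edge `e` lies to the left of the edge `g`. -/
def LeftOf {V₁ V₂ : Type*} (σ₁ : V₁ → ℝ) (σ₂ : V₂ → ℝ) (e g : V₁ × V₂) : Prop :=
  σ₁ e.1 ≤ σ₁ g.1 ∧ σ₂ e.2 ≤ σ₂ g.2 ∧ (σ₁ e.1 < σ₁ g.1 ∨ σ₂ e.2 < σ₂ g.2)

/-- The edge `e` lies to the right of the edge `g`. -/
def RightOf {V₁ V₂ : Type*} (σ₁ : V₁ → ℝ) (σ₂ : V₂ → ℝ) (e g : V₁ × V₂) : Prop :=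
  LeftOf σ₁ σ₂ g e

/-- A set of edges none of which is blue has total multiplicity at most `2 * √k`. -/
theorem sum_le_of_not_blue {V₁ V₂ : Type*} (E : Finset (V₁ × V₂)) (μ : V₁ × V₂ → ℕ)
    (σ₁ : V₁ → ℝ) (σ₂ : V₂ → ℝ) {k : ℕ} (hk : 1 ≤ k) (hcr : wCrossNum E μ σ₁ σ₂ = k)
    {S : Finset (V₁ × V₂)} (hSE : S ⊆ E) (hS : ∀ e ∈ S, ¬ Blue E μ σ₁ σ₂ k e) :
    ∑ e ∈ S, (μ e : ℝ) ≤ 2 * Real.sqrt k := by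
  have hpos : 0 < Real.sqrt k := Real.sqrt_pos.2 (by exact_mod_cast hk)
  refine le_of_mul_le_mul_right ?_ hpos
  calc (∑ e ∈ S, (μ e : ℝ)) * Real.sqrt k
      ≤ ∑ e ∈ S, (μ e : ℝ) * wLoad E μ σ₁ σ₂ e := by
        rw [sum_mul]
        exact sum_le_sum fun e he =>
          mul_le_mul_of_nonneg_left (not_le.1 (hS e he)).le (Nat.cast_nonneg _)
    _ ≤ ∑ e ∈ E, (μ e : ℝ) * wLoad E μ σ₁ σ₂ e :=
        sum_le_sum_of_subset_of_nonneg hSE fun _ _ _ => by positivity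
    _ = 2 * k := by
        have h := sum_mul_wLoad E μ σ₁ σ₂
        rw [hcr] at h
        exact_mod_cast h
    _ = 2 * Real.sqrt k * Real.sqrt k := by
        rw [mul_assoc, Real.mul_self_sqrt (Nat.cast_nonneg k)]

theorem LeftOf.not_cross2 {V₁ V₂ : Type*} {σ₁ : V₁ → ℝ} {σ₂ : V₂ → ℝ} {e g : V₁ × V₂}
    (h : LeftOf σ₁ σ₂ e g) : ¬ Cross2 σ₁ σ₂ e g := by
  rintro (⟨_, h₂⟩ | ⟨h₁, _⟩)
  · exact h₂.not_ge h.2.1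
  · exact h₁.not_ge h.1

theorem LeftOf.add_lt_add {V₁ V₂ : Type*} {σ₁ : V₁ → ℝ} {σ₂ : V₂ → ℝ} {e g : V₁ × V₂}
    (h : LeftOf σ₁ σ₂ e g) : σ₁ e.1 + σ₂ e.2 < σ₁ g.1 + σ₂ g.2 := by
  obtain ⟨h₁, h₂, h₃ | h₃⟩ := h <;> linarith

theorem leftOf_of_le_of_ne {V₁ V₂ : Type*} {σ₁ : V₁ → ℝ} {σ₂ : V₂ → ℝ}
    (hσ₁ : Function.Injective σ₁) (hσ₂ : Function.Injective σ₂) {e g : V₁ × V₂}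
    (h₁ : σ₁ e.1 ≤ σ₁ g.1) (h₂ : σ₂ e.2 ≤ σ₂ g.2) (hne : e ≠ g) : LeftOf σ₁ σ₂ e g := by
  refine ⟨h₁, h₂, ?_⟩
  by_contra! h
  exact hne (Prod.ext (hσ₁ (le_antisymm h₁ h.1)) (hσ₂ (le_antisymm h₂ h.2)))

theorem blue_of_not_cross2 {V₁ V₂ : Type*} {E : Finset (V₁ × V₂)} {μ : V₁ × V₂ → ℕ}
    {σ₁ : V₁ → ℝ} {σ₂ : V₂ → ℝ} {e : V₁ × V₂} (k : ℕ)
    (h : ∀ f ∈ E, ¬ Cross2 σ₁ σ₂ e f) : Blue E μ σ₁ σ₂ k e := by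
  rw [Blue, wLoad, filter_false_of_mem h]
  simp

/-- The weighted number of crossings between edges to the left of `g`. -/
noncomputable def leftCrossNum {V₁ V₂ : Type*} (E : Finset (V₁ × V₂)) (μ : V₁ × V₂ → ℕ)
    (σ₁ : V₁ → ℝ) (σ₂ : V₂ → ℝ) (g : V₁ × V₂) : ℝ :=
  ∑ p ∈ (E ×ˢ E).filter (fun p =>
      (σ₁ p.1.1 < σ₁ p.2.1 ∧ σ₂ p.2.2 < σ₂ p.1.2) ∧
      LeftOf σ₁ σ₂ p.1 g ∧ LeftOf σ₁ σ₂ p.2 g),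
    (μ p.1 * μ p.2 : ℝ)

/-- The weighted number of crossings between edges to the right of `g`. -/
noncomputable def rightCrossNum {V₁ V₂ : Type*} (E : Finset (V₁ × V₂)) (μ : V₁ × V₂ → ℕ)
    (σ₁ : V₁ → ℝ) (σ₂ : V₂ → ℝ) (g : V₁ × V₂) : ℝ :=
  ∑ p ∈ (E ×ˢ E).filter (fun p =>
      (σ₁ p.1.1 < σ₁ p.2.1 ∧ σ₂ p.2.2 < σ₂ p.1.2) ∧
      RightOf σ₁ σ₂ p.1 g ∧ RightOf σ₁ σ₂ p.2 g),
    (μ p.1 * μ p.2 : ℝ)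

theorem leftCrossNum_add_rightCrossNum_le {V₁ V₂ : Type*} (E : Finset (V₁ × V₂))
    (μ : V₁ × V₂ → ℕ) (σ₁ : V₁ → ℝ) (σ₂ : V₂ → ℝ) (g : V₁ × V₂) :
    leftCrossNum E μ σ₁ σ₂ g + rightCrossNum E μ σ₁ σ₂ g ≤ wCrossNum E μ σ₁ σ₂ := by
  rw [leftCrossNum, rightCrossNum, ← sum_union]
  · rw [wCrossNum]
    push_cast
    refine sum_le_sum_of_subset_of_nonneg (fun p hp => ?_) fun _ _ _ => by positivity
    simp only [mem_union, mem_filter] at hp ⊢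
    tauto
  · refine disjoint_filter.2 fun p _ hl hr => ?_
    exact lt_asymm hl.2.1.add_lt_add (LeftOf.add_lt_add hr.2.1)

theorem leftCrossNum_eq_zero {V₁ V₂ : Type*} {E : Finset (V₁ × V₂)} {μ : V₁ × V₂ → ℕ}
    {σ₁ : V₁ → ℝ} {σ₂ : V₂ → ℝ} {g : V₁ × V₂} (h : ∀ e ∈ E, ¬ LeftOf σ₁ σ₂ e g) :
    leftCrossNum E μ σ₁ σ₂ g = 0 := by
  rw [leftCrossNum, filter_false_of_mem, sum_empty]
  exact fun p hp hl => h _ (mem_product.1 hp).1 hl.2.1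

theorem leftCrossNum_eq_wCrossNum {V₁ V₂ : Type*} {E : Finset (V₁ × V₂)} {μ : V₁ × V₂ → ℕ}
    {σ₁ : V₁ → ℝ} {σ₂ : V₂ → ℝ} {g : V₁ × V₂} (h : ∀ e ∈ E, e ≠ g → LeftOf σ₁ σ₂ e g) :
    leftCrossNum E μ σ₁ σ₂ g = wCrossNum E μ σ₁ σ₂ := by
  rw [leftCrossNum, wCrossNum]
  push_cast
  refine sum_congr (filter_congr fun p hp => and_iff_left_of_imp fun hp' => ?_) fun _ _ => rfl
  obtain ⟨he, hf⟩ := mem_product.1 hp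
  have hne : p.1 ≠ p.2 := fun heq => hp'.1.ne (by rw [heq])
  refine ⟨h _ he fun heq => ?_, h _ hf fun heq => ?_⟩
  · exact hp'.1.not_ge (heq ▸ (h _ hf (heq ▸ hne.symm)).1)
  · exact hp'.2.not_ge (heq ▸ (h _ he (heq ▸ hne)).2.1)

theorem sum_cross2_or_le {V₁ V₂ : Type*} {E : Finset (V₁ × V₂)} {μ : V₁ × V₂ → ℕ}
    {σ₁ : V₁ → ℝ} {σ₂ : V₂ → ℝ} {k : ℕ} {e g : V₁ × V₂}
    (he : Blue E μ σ₁ σ₂ k e) (hg : Blue E μ σ₁ σ₂ k g) :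
    ∑ f ∈ E.filter (fun f => Cross2 σ₁ σ₂ e f ∨ Cross2 σ₁ σ₂ g f), (μ f : ℝ)
      ≤ 2 * Real.sqrt k := by
  have h : ∑ f ∈ E.filter (fun f => Cross2 σ₁ σ₂ e f ∨ Cross2 σ₁ σ₂ g f), μ f
      ≤ wLoad E μ σ₁ σ₂ e + wLoad E μ σ₁ σ₂ g := by
    rw [filter_or, wLoad, wLoad, ← sum_union_inter]
    exact Nat.le_add_right _ _
  have h' : ∑ f ∈ E.filter (fun f => Cross2 σ₁ σ₂ e f ∨ Cross2 σ₁ σ₂ g f), (μ f : ℝ)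
      ≤ wLoad E μ σ₁ σ₂ e + wLoad E μ σ₁ σ₂ g := by exact_mod_cast h
  rw [Blue] at he hg
  linarith

/-- Separator lemma for two layers. -/
theorem separator_lemma_two_layers {V₁ V₂ : Type*} [Fintype V₁] [Fintype V₂]
    (E : Finset (V₁ × V₂)) (μ : V₁ × V₂ → ℕ) (hμ : ∀ e ∈ E, 1 ≤ μ e)
    (σ₁ : V₁ → ℝ) (σ₂ : V₂ → ℝ)
    (hσ₁ : Function.Injective σ₁) (hσ₂ : Function.Injective σ₂)
    (k : ℕ) (hk : 1 ≤ k) (hcr : wCrossNum E μ σ₁ σ₂ = k)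
    (lb rb : V₁ × V₂) (hlb : lb ∈ E) (hrb : rb ∈ E)
    (hbound : ∀ e ∈ E, σ₁ lb.1 ≤ σ₁ e.1 ∧ σ₁ e.1 ≤ σ₁ rb.1 ∧
      σ₂ lb.2 ≤ σ₂ e.2 ∧ σ₂ e.2 ≤ σ₂ rb.2) :
    ∃ lsep ∈ E, ∃ rsep ∈ E, lsep ≠ rsep ∧
      Blue E μ σ₁ σ₂ k lsep ∧ Blue E μ σ₁ σ₂ k rsep ∧
      LeftOf σ₁ σ₂ lsep rsep ∧ ¬ Cross2 σ₁ σ₂ lsep rsep ∧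
      (∑ p ∈ (E ×ˢ E).filter (fun p =>
            (σ₁ p.1.1 < σ₁ p.2.1 ∧ σ₂ p.2.2 < σ₂ p.1.2) ∧
            LeftOf σ₁ σ₂ p.1 lsep ∧ LeftOf σ₁ σ₂ p.2 lsep),
          (μ p.1 * μ p.2 : ℝ)) ≤ (k : ℝ) / 2 ∧
      (∑ p ∈ (E ×ˢ E).filter (fun p =>
            (σ₁ p.1.1 < σ₁ p.2.1 ∧ σ₂ p.2.2 < σ₂ p.1.2) ∧
            RightOf σ₁ σ₂ p.1 rsep ∧ RightOf σ₁ σ₂ p.2 rsep),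
          (μ p.1 * μ p.2 : ℝ)) ≤ (k : ℝ) / 2 ∧
      (∑ e ∈ E.filter (fun e => e ≠ lsep ∧ e ≠ rsep ∧
            σ₁ lsep.1 ≤ σ₁ e.1 ∧ σ₁ e.1 ≤ σ₁ rsep.1 ∧
            σ₂ lsep.2 ≤ σ₂ e.2 ∧ σ₂ e.2 ≤ σ₂ rsep.2),
          (μ e : ℝ)) ≤ 2 * Real.sqrt k ∧
      (∑ e ∈ E.filter (fun e => Cross2 σ₁ σ₂ lsep e ∨ Cross2 σ₁ σ₂ rsep e),
          (μ e : ℝ)) ≤ 2 * Real.sqrt k := by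
  have hk₀ : (0 : ℝ) < k := by exact_mod_cast hk
  have hlb_blue : Blue E μ σ₁ σ₂ k lb := blue_of_not_cross2 k fun f hf => by
    rintro (h | h)
    · exact h.2.not_ge (hbound f hf).2.2.1
    · exact h.1.not_ge (hbound f hf).1
  have hrb_blue : Blue E μ σ₁ σ₂ k rb := blue_of_not_cross2 k fun f hf => by
    rintro (h | h)
    · exact h.1.not_ge (hbound f hf).2.1
    · exact h.2.not_ge (hbound f hf).2.2.2
  have hlb_zero : leftCrossNum E μ σ₁ σ₂ lb = 0 := leftCrossNum_eq_zero fun e he h => by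
    have := hbound e he
    linarith [h.add_lt_add]
  have hle_rb : ∀ e ∈ E, e ≠ rb → LeftOf σ₁ σ₂ e rb := fun e he hne =>
    leftOf_of_le_of_ne hσ₁ hσ₂ (hbound e he).2.1 (hbound e he).2.2.2 hne
  have hrb_all : leftCrossNum E μ σ₁ σ₂ rb = k := by
    rw [leftCrossNum_eq_wCrossNum hle_rb, hcr]
  obtain ⟨l, hl, hl_max⟩ := exists_max_image
    (E.filter fun e => Blue E μ σ₁ σ₂ k e ∧ leftCrossNum E μ σ₁ σ₂ e ≤ (k : ℝ) / 2)
    (fun e => σ₁ e.1 + σ₂ e.2)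
    ⟨lb, mem_filter.2 ⟨hlb, hlb_blue, by rw [hlb_zero]; positivity⟩⟩
  obtain ⟨hlE, hl_blue, hl_half⟩ := mem_filter.1 hl
  have hl_rb : LeftOf σ₁ σ₂ l rb := hle_rb l hlE (by rintro rfl; linarith)
  obtain ⟨r, hr, hr_min⟩ := exists_min_image
    (E.filter fun e => Blue E μ σ₁ σ₂ k e ∧ LeftOf σ₁ σ₂ l e)
    (fun e => σ₁ e.1 + σ₂ e.2) ⟨rb, mem_filter.2 ⟨hrb, hrb_blue, hl_rb⟩⟩
  obtain ⟨hrE, hr_blue, hlr⟩ := mem_filter.1 hr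
  have hr_half : (k : ℝ) / 2 < leftCrossNum E μ σ₁ σ₂ r := by
    by_contra! h
    exact (hl_max r (mem_filter.2 ⟨hrE, hr_blue, h⟩)).not_gt hlr.add_lt_add
  have hsum := leftCrossNum_add_rightCrossNum_le E μ σ₁ σ₂ r
  rw [hcr] at hsum
  have hr_right : rightCrossNum E μ σ₁ σ₂ r ≤ (k : ℝ) / 2 := by linarith
  refine ⟨l, hlE, r, hrE, ?_, hl_blue, hr_blue, hlr, hlr.not_cross2, hl_half, hr_right,
    sum_le_of_not_blue E μ σ₁ σ₂ hk hcr (filter_subset _ _) ?_,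
    sum_cross2_or_le hl_blue hr_blue⟩
  · rintro rfl
    exact hlr.add_lt_add.false
  · intro e he he_blue
    obtain ⟨heE, hel, her, h₁, h₂, h₃, h₄⟩ := mem_filter.1 he
    have hle := leftOf_of_le_of_ne hσ₁ hσ₂ h₁ h₃ hel.symm
    have her' := leftOf_of_le_of_ne hσ₁ hσ₂ h₂ h₄ her
    exact (hr_min e (mem_filter.2 ⟨heE, he_blue, hle⟩)).not_gt her'.add_lt_add
end

section
/- Let σ be a 2-layer drawing of a 2-layer graph (V₁,V₂,E). Let v ∈ V₁, let u₁,…,u_r ∈ V₂ be pairwise distinct vertices with (v,uᵢ) ∈ E for every i, and let l₁,…,l_r ∈ V₁ be pairwise distinct vertices with (lᵢ,uᵢ) ∈ E for every i and σ₁(v) < σ₁(l₁) < σ₁(l₂) < ⋯ < σ₁(l_r). Then the number of unordered pairs of edges from the set {(v,uᵢ) : 1 ≤ i ≤ r} ∪ {(lᵢ,uᵢ) : 1 ≤ i ≤ r} that cross in σ is at least r(r−1)/2. -/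
open Finset
open scoped Classical

/-- The set of edges `{(v, uᵢ)} ∪ {(lᵢ, uᵢ)}`. -/
def starSet {V₁ V₂ : Type*} [DecidableEq V₁] [DecidableEq V₂]
    (v : V₁) (r : ℕ) (u : Fin r → V₂) (l : Fin r → V₁) : Finset (V₁ × V₂) :=
  ((Finset.univ : Finset (Fin r)).image fun i => (v, u i)) ∪
    ((Finset.univ : Finset (Fin r)).image fun i => (l i, u i))

/-- Exactly half of the ordered pairs of distinct points are strictly ordered one way by an
injective function to a linear order. -/
theorem Finset.two_mul_card_filter_lt_of_injective {ι α : Type*} [Fintype ι] [LinearOrder α]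
    {f : ι → α} (hf : Function.Injective f) :
    2 * #{p : ι × ι | f p.2 < f p.1} = Fintype.card ι * (Fintype.card ι - 1) := by
  have hswap : #{p : ι × ι | f p.1 < f p.2} = #{p : ι × ι | f p.2 < f p.1} :=
    Finset.card_equiv (Equiv.prodComm ι ι) (by simp)
  have hunion : (Finset.univ : Finset ι).offDiag =
      ({p : ι × ι | f p.1 < f p.2} : Finset _) ∪
        ({p : ι × ι | f p.2 < f p.1} : Finset _) := by
    ext ⟨i, j⟩
    simp [← hf.ne_iff (x := i), lt_or_lt_iff_ne]
  have hdisj : Disjoint ({p : ι × ι | f p.1 < f p.2} : Finset _)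
      ({p : ι × ι | f p.2 < f p.1} : Finset _) :=
    Finset.disjoint_filter.2 fun _ _ h => h.not_gt
  rw [Nat.mul_sub_one, ← Finset.card_univ, ← Finset.offDiag_card, hunion,
    Finset.card_union_of_disjoint hdisj, hswap, two_mul]

theorem updown_staircase_crossings {V₁ V₂ : Type*} [Fintype V₁] [Fintype V₂]
    [DecidableEq V₁] [DecidableEq V₂]
    (E : Finset (V₁ × V₂))
    (σ₁ : V₁ → ℝ) (σ₂ : V₂ → ℝ)
    (hσ₁ : Function.Injective σ₁) (hσ₂ : Function.Injective σ₂)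
    (v : V₁) (r : ℕ) (u : Fin r → V₂) (l : Fin r → V₁)
    (hu : Function.Injective u) (hl : Function.Injective l)
    (huE : ∀ i, (v, u i) ∈ E) (hlE : ∀ i, (l i, u i) ∈ E)
    (hvl : ∀ i, σ₁ v < σ₁ (l i))
    (hmono : ∀ i j : Fin r, i < j → σ₁ (l i) < σ₁ (l j)) :
    r * (r - 1) / 2 ≤
      ((starSet v r u l ×ˢ starSet v r u l).filter
        (fun p => σ₁ p.1.1 < σ₁ p.2.1 ∧ σ₂ p.2.2 < σ₂ p.1.2)).card := by
  have hcard := Finset.two_mul_card_filter_lt_of_injective (hσ₂.comp hu)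
  rw [Fintype.card_fin] at hcard
  rw [← hcard, Nat.mul_div_cancel_left _ two_pos]
  refine Finset.card_le_card_of_injOn (fun p => ((v, u p.1), (l p.2, u p.2))) ?_ ?_
  · rintro ⟨i, j⟩ hij
    have hlt : σ₂ (u j) < σ₂ (u i) := by simpa using hij
    have hvu : (v, u i) ∈ starSet v r u l :=
      Finset.mem_union_left _ (Finset.mem_image_of_mem _ (Finset.mem_univ i))
    have hlu : (l j, u j) ∈ starSet v r u l :=
      Finset.mem_union_right _ (Finset.mem_image_of_mem (fun i => (l i, u i)) (Finset.mem_univ j))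
    simp [hvu, hlu, hvl j, hlt]
  · rintro ⟨i, j⟩ _ ⟨i', j'⟩ _ h
    simp only [Prod.mk.injEq] at h
    exact Prod.ext (hu h.1.2) (hu h.2.2)
end

section
/- Let k ≥ 1 be a natural number, let G be a 2-layer graph (V₁,V₂,E) regarded as a bipartite graph on V₁ ∪ V₂, and let σ be a 2-layer drawing of G with at most k crossings. Then for every vertex v of G, the number of connected components of G − v that contain both a neighbour of v and a vertex lying in the same part (V₁ or V₂) as v is at most 4·√k. -/
open Finset
open scoped Classical

/-- The number of crossings of a drawing of a 2-layer graph: every unordered crossing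
pair of edges of `E` is counted exactly once (via the one-sided order condition). -/
noncomputable def crossNum {V₁ V₂ : Type*} (E : Finset (V₁ × V₂))
    (σ₁ : V₁ → ℝ) (σ₂ : V₂ → ℝ) : ℕ :=
  ((E ×ˢ E).filter (fun p => σ₁ p.1.1 < σ₁ p.2.1 ∧ σ₂ p.2.2 < σ₂ p.1.2)).card

/-- The bipartite graph on `V₁ ⊕ V₂` determined by the edge set `E ⊆ V₁ × V₂`. -/
def layerGraph {V₁ V₂ : Type*} (E : Finset (V₁ × V₂)) : SimpleGraph (V₁ ⊕ V₂) :=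
  SimpleGraph.fromRel fun x y => ∃ e ∈ E, x = Sum.inl e.1 ∧ y = Sum.inr e.2

theorem crossNum_neg_le {V₁ V₂ : Type*} (E : Finset (V₁ × V₂)) (σ₁ : V₁ → ℝ) (σ₂ : V₂ → ℝ) :
    crossNum E (-σ₁) (-σ₂) ≤ crossNum E σ₁ σ₂ := by
  refine Finset.card_le_card_of_injOn Prod.swap ?_ Prod.swap_injective.injOn
  intro p hp
  simp only [Finset.coe_filter, Finset.mem_product, Set.mem_ofPred_eq, Pi.neg_apply,
    neg_lt_neg_iff, Prod.fst_swap, Prod.snd_swap] at hp ⊢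
  tauto

theorem crossNum_prodComm_le {V₁ V₂ : Type*} (E : Finset (V₁ × V₂))
    (σ₁ : V₁ → ℝ) (σ₂ : V₂ → ℝ) :
    crossNum (E.map (Equiv.prodComm V₁ V₂).toEmbedding) σ₂ σ₁ ≤ crossNum E σ₁ σ₂ := by
  refine Finset.card_le_card_of_injOn (fun p => (p.2.swap, p.1.swap)) ?_ ?_
  · rintro ⟨⟨a, b⟩, ⟨c, d⟩⟩ hp
    simp only [Finset.coe_filter, Finset.mem_product, Set.mem_ofPred_eq, Finset.mem_map_equiv,
      Equiv.prodComm_symm, Equiv.prodComm_apply, Prod.swap_prod_mk] at hp ⊢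
    tauto
  · rintro ⟨⟨a, b⟩, ⟨c, d⟩⟩ - ⟨⟨a', b'⟩, ⟨c', d'⟩⟩ - h
    simp only [Prod.swap_prod_mk, Prod.mk.injEq] at h ⊢
    tauto

/-- Paths `v - x i - u i` whose end vertices all lie to the right of `v` cross pairwise. -/
theorem card_offDiag_le_two_mul_crossNum {V₁ V₂ ι : Type*} (E : Finset (V₁ × V₂))
    (σ₁ : V₁ → ℝ) (σ₂ : V₂ → ℝ) (hσ₂ : Function.Injective σ₂) (v : V₁) (S : Finset ι)
    (x : ι → V₂) (u : ι → V₁) (hx : Function.Injective x)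
    (hvx : ∀ i, (v, x i) ∈ E) (hux : ∀ i, (u i, x i) ∈ E) (hvu : ∀ i ∈ S, σ₁ v < σ₁ (u i)) :
    S.offDiag.card ≤ 2 * crossNum E σ₁ σ₂ := by
  rw [← Finset.card_filter_add_card_filter_not (s := S.offDiag)
    (fun p => σ₂ (x p.1) < σ₂ (x p.2)), two_mul]
  refine add_le_add ?_ ?_
  · refine Finset.card_le_card_of_injOn
      (fun p => ((v, x p.2), (u p.1, x p.1))) ?_ ?_
    · rintro ⟨i, j⟩ hp
      simp only [Finset.coe_filter, Finset.mem_offDiag, Set.mem_ofPred_eq,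
        Finset.mem_product] at hp ⊢
      exact ⟨⟨hvx _, hux _⟩, hvu _ hp.1.1, hp.2⟩
    · rintro ⟨i, j⟩ - ⟨i', j'⟩ - h
      simp only [Prod.mk.injEq] at h ⊢
      exact ⟨hx h.2.2, hx h.1.2⟩
  · refine Finset.card_le_card_of_injOn
      (fun p => ((v, x p.1), (u p.2, x p.2))) ?_ ?_
    · rintro ⟨i, j⟩ hp
      simp only [Finset.coe_filter, Finset.mem_offDiag, Set.mem_ofPred_eq,
        Finset.mem_product, not_lt] at hp ⊢
      refine ⟨⟨hvx _, hux _⟩, hvu _ hp.1.2.1, lt_of_le_of_ne hp.2 fun h => hp.1.2.2 ?_⟩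
      exact (hx (hσ₂ h)).symm
    · rintro ⟨i, j⟩ - ⟨i', j'⟩ - h
      simp only [Prod.mk.injEq] at h ⊢
      exact ⟨hx h.1.2, hx h.2.2⟩

theorem card_le_two_mul_sqrt_of_card_offDiag_le {ι : Type*} (S : Finset ι) (k : ℕ) (hk : 1 ≤ k)
    (h : S.offDiag.card ≤ 2 * k) : (S.card : ℝ) ≤ 2 * Real.sqrt k := by
  have hsq : S.card ^ 2 ≤ 4 * k := by
    rw [Finset.offDiag_card] at h
    have h' : S.card * S.card ≤ 2 * k + S.card := by omega
    nlinarith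
  have hsq' : (S.card : ℝ) ^ 2 ≤ 4 * k := by exact_mod_cast hsq
  refine abs_le_of_sq_le_sq' ?_ (by positivity) |>.2
  rw [mul_pow, Real.sq_sqrt (Nat.cast_nonneg k)]
  linarith

theorem card_paths_le_four_mul_sqrt {V₁ V₂ ι : Type*} [Fintype ι] (E : Finset (V₁ × V₂))
    (k : ℕ) (hk : 1 ≤ k) (σ₁ : V₁ → ℝ) (σ₂ : V₂ → ℝ) (hσ₁ : Function.Injective σ₁)
    (hσ₂ : Function.Injective σ₂) (hcr : crossNum E σ₁ σ₂ ≤ k) (v : V₁)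
    (x : ι → V₂) (u : ι → V₁) (hx : Function.Injective x)
    (hvx : ∀ i, (v, x i) ∈ E) (hux : ∀ i, (u i, x i) ∈ E) (huv : ∀ i, u i ≠ v) :
    (Fintype.card ι : ℝ) ≤ 4 * Real.sqrt k := by
  have hright := card_le_two_mul_sqrt_of_card_offDiag_le
    (Finset.univ.filter fun i => σ₁ v < σ₁ (u i)) k hk <|
    (card_offDiag_le_two_mul_crossNum E σ₁ σ₂ hσ₂ v _ x u hx hvx hux (by simp)).trans (by omega)
  have hleft := card_le_two_mul_sqrt_of_card_offDiag_le
    (Finset.univ.filter fun i => ¬ σ₁ v < σ₁ (u i)) k hk <|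
    (card_offDiag_le_two_mul_crossNum E (-σ₁) (-σ₂) (neg_injective.comp hσ₂) v _ x u hx hvx hux
      (fun i hi => neg_lt_neg <| lt_of_le_of_ne (not_lt.1 (Finset.mem_filter.1 hi).2)
        (hσ₁.ne (huv i)))).trans
      (by have := crossNum_neg_le E σ₁ σ₂; omega)
  have hsum := Finset.card_filter_add_card_filter_not (s := (Finset.univ : Finset ι))
    (fun i => σ₁ v < σ₁ (u i))
  rw [Finset.card_univ] at hsum
  rw [← hsum]
  push_cast
  linarith

theorem SimpleGraph.Reachable.exists_adj_of_ne {V : Type*} {G : SimpleGraph V} {a b : V}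
    (h : G.Reachable a b) (hab : a ≠ b) : ∃ c, G.Adj a c := by
  obtain ⟨p⟩ := h
  cases p with
  | nil => exact absurd rfl hab
  | cons hadj _ => exact ⟨_, hadj⟩

theorem layerGraph_adj_inl {V₁ V₂ : Type*} {E : Finset (V₁ × V₂)} {a : V₁} {y : V₁ ⊕ V₂} :
    (layerGraph E).Adj (Sum.inl a) y ↔ ∃ b, y = Sum.inr b ∧ (a, b) ∈ E := by
  cases y <;> simp [layerGraph]

theorem layerGraph_adj_inr {V₁ V₂ : Type*} {E : Finset (V₁ × V₂)} {b : V₂} {y : V₁ ⊕ V₂} :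
    (layerGraph E).Adj (Sum.inr b) y ↔ ∃ a, y = Sum.inl a ∧ (a, b) ∈ E := by
  cases y <;> simp [layerGraph]

/-- A component of `G - v` with a neighbour of `v` and another vertex contains the rest of a path
of length two starting at `v`. -/
theorem SimpleGraph.exists_adj_adj_of_mem_component {V : Type*} {G : SimpleGraph V} {v : V}
    {c : (G.induce {w | w ≠ v}).ConnectedComponent} {y w : V} (hy : y ≠ v) (hw : w ≠ v)
    (hyw : y ≠ w) (hyc : (G.induce {w | w ≠ v}).connectedComponentMk ⟨y, hy⟩ = c)
    (hwc : (G.induce {w | w ≠ v}).connectedComponentMk ⟨w, hw⟩ = c) :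
    ∃ z, z ≠ v ∧ G.Adj y z := by
  obtain ⟨z, hz⟩ := (SimpleGraph.ConnectedComponent.exact (hyc.trans hwc.symm)).exists_adj_of_ne
    fun h => hyw (congrArg Subtype.val h)
  exact ⟨z, z.2, hz⟩

/-- In a 2-layer drawing with at most `k` crossings, for every vertex `v`, the number of
connected components of `G - v` containing both a neighbour of `v` and a vertex in the
same part as `v` is at most `4√k`. -/
theorem updown_components_bound {V₁ V₂ : Type*} [Fintype V₁] [Fintype V₂]
    [DecidableEq V₁] [DecidableEq V₂]
    (E : Finset (V₁ × V₂)) (k : ℕ) (hk : 1 ≤ k)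
    (σ₁ : V₁ → ℝ) (σ₂ : V₂ → ℝ)
    (hσ₁ : Function.Injective σ₁) (hσ₂ : Function.Injective σ₂)
    (hcr : crossNum E σ₁ σ₂ ≤ k) (v : V₁ ⊕ V₂) :
    (Set.ncard {c : ((layerGraph E).induce {w | w ≠ v}).ConnectedComponent |
        (∃ x, ∃ hx : x ≠ v, (layerGraph E).Adj v x ∧
          ((layerGraph E).induce {w | w ≠ v}).connectedComponentMk ⟨x, hx⟩ = c) ∧
        (∃ x : V₁ ⊕ V₂, ∃ hx : x ≠ v, x.isLeft = v.isLeft ∧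
          ((layerGraph E).induce {w | w ≠ v}).connectedComponentMk ⟨x, hx⟩ = c)} : ℝ)
      ≤ 4 * Real.sqrt k := by
  set C := {c : ((layerGraph E).induce {w | w ≠ v}).ConnectedComponent | _}
  rw [← Nat.card_coe_set_eq, Nat.card_eq_fintype_card]
  cases v with
  | inl v =>
    have key : ∀ c : C, ∃ (x : V₂) (u : V₁), (v, x) ∈ E ∧ (u, x) ∈ E ∧ u ≠ v ∧
        ((layerGraph E).induce {w | w ≠ Sum.inl v}).connectedComponentMk
          ⟨Sum.inr x, Sum.inr_ne_inl⟩ = c.1 := by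
      rintro ⟨c, ⟨y, hy, hvy, hyc⟩, w, hw, hwv, hwc⟩
      obtain ⟨x, rfl, hvx⟩ := layerGraph_adj_inl.1 hvy
      obtain ⟨z, hz, hxz⟩ := SimpleGraph.exists_adj_adj_of_mem_component hy hw
        (by rintro rfl; simp at hwv) hyc hwc
      obtain ⟨u, rfl, hux⟩ := layerGraph_adj_inr.1 hxz
      exact ⟨x, u, hvx, hux, fun h => hz (congrArg _ h), hyc⟩
    choose x u hvx hux huv hxc using key
    refine card_paths_le_four_mul_sqrt E k hk σ₁ σ₂ hσ₁ hσ₂ hcr v x u ?_ hvx hux huv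
    intro c d hcd
    apply Subtype.ext
    rw [← hxc c, ← hxc d]
    simp only [hcd]
  | inr v =>
    have key : ∀ c : C, ∃ (x : V₁) (u : V₂), (x, v) ∈ E ∧ (x, u) ∈ E ∧ u ≠ v ∧
        ((layerGraph E).induce {w | w ≠ Sum.inr v}).connectedComponentMk
          ⟨Sum.inl x, Sum.inl_ne_inr⟩ = c.1 := by
      rintro ⟨c, ⟨y, hy, hvy, hyc⟩, w, hw, hwv, hwc⟩
      obtain ⟨x, rfl, hvx⟩ := layerGraph_adj_inr.1 hvy
      obtain ⟨z, hz, hxz⟩ := SimpleGraph.exists_adj_adj_of_mem_component hy hw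
        (by rintro rfl; simp at hwv) hyc hwc
      obtain ⟨u, rfl, hux⟩ := layerGraph_adj_inl.1 hxz
      exact ⟨x, u, hvx, hux, fun h => hz (congrArg _ h), hyc⟩
    choose x u hvx hux huv hxc using key
    refine card_paths_le_four_mul_sqrt (E.map (Equiv.prodComm V₁ V₂).toEmbedding) k hk σ₂ σ₁
      hσ₂ hσ₁ ((crossNum_prodComm_le E σ₁ σ₂).trans hcr) v x u ?_
      (fun c => by simpa using hvx c) (fun c => by simpa using hux c) huv
    intro c d hcd
    apply Subtype.ext
    rw [← hxc c, ← hxc d]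
    simp only [hcd]
end

section
/- Let (V₁,V₂,E) be a 2-layer graph with edge multiplicities μ and let σ be a 2-layer drawing whose weighted number of crossings is minimum among all 2-layer drawings of (V₁,V₂,E). Let v ∈ V₁ and let w, w' ∈ V₂ be distinct vertices each incident to exactly one edge of E, namely (v,w) and (v,w') respectively. Then the weighted crossing load in σ of the edge (v,w) equals the weighted crossing load in σ of the edge (v,w'). -/
open Finset
open scoped Classical

/-- Removing an edge `e` from the graph lowers the crossing number by `μ e` times its load. -/
theorem wCrossNum_eq_erase_add {V₁ V₂ : Type*} (E : Finset (V₁ × V₂)) (μ : V₁ × V₂ → ℕ)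
    (σ₁ : V₁ → ℝ) (σ₂ : V₂ → ℝ) {e : V₁ × V₂} (he : e ∈ E) :
    wCrossNum E μ σ₁ σ₂ = wCrossNum (E.erase e) μ σ₁ σ₂ + μ e * wLoad E μ σ₁ σ₂ e := by
  obtain ⟨F, heF, rfl⟩ : ∃ F, e ∉ F ∧ insert e F = E :=
    ⟨E.erase e, notMem_erase e E, insert_erase he⟩
  rw [erase_insert heF]
  have hself : ¬ Cross2 σ₁ σ₂ e e := by simp [Cross2]
  rw [wLoad, filter_insert, if_neg hself]
  simp only [wCrossNum, sum_filter, sum_product, sum_insert heF, sum_add_distrib,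
    lt_irrefl, false_and, if_false, zero_add, mul_sum]
  rw [add_left_comm, add_comm (∑ f ∈ F, _) (∑ f ∈ F, ∑ g ∈ F, _), add_left_comm]
  rw [← sum_add_distrib]
  congr 1
  refine sum_congr rfl fun f _ => ?_
  by_cases h₁ : σ₁ e.1 < σ₁ f.1 ∧ σ₂ f.2 < σ₂ e.2
  · have h₂ : ¬ (σ₁ f.1 < σ₁ e.1 ∧ σ₂ e.2 < σ₂ f.2) := fun h => lt_asymm h.1 h₁.1
    simp [Cross2, h₁, h₂]
  · by_cases h₂ : σ₁ f.1 < σ₁ e.1 ∧ σ₂ e.2 < σ₂ f.2 <;> simp [Cross2, h₁, h₂, mul_comm]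

/-- The crossing number depends only on the positions of the endpoints in `V₂` of the edges. -/
theorem wCrossNum_congr {V₁ V₂ : Type*} (E : Finset (V₁ × V₂)) (μ : V₁ × V₂ → ℕ)
    (σ₁ : V₁ → ℝ) {σ₂ τ₂ : V₂ → ℝ} (h : ∀ e ∈ E, τ₂ e.2 = σ₂ e.2) :
    wCrossNum E μ σ₁ τ₂ = wCrossNum E μ σ₁ σ₂ := by
  refine sum_congr (filter_congr fun p hp => ?_) fun _ _ => rfl
  rw [h _ (mem_product.1 hp).1, h _ (mem_product.1 hp).2]

/-- A placement of finitely many vertices leaves a free position immediately to the right of any point. -/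
theorem exists_gap_right {V : Type*} [Finite V] (σ : V → ℝ) (a : ℝ) :
    ∃ c, a < c ∧ ∀ u, σ u ≤ a ∨ c < σ u := by
  have hgap : ∀ᶠ c in nhdsWithin a (Set.Ioi a), ∀ u, σ u ≤ a ∨ c < σ u := by
    refine Filter.eventually_all.2 fun u => ?_
    rcases le_or_gt (σ u) a with hu | hu
    · exact Filter.Eventually.of_forall fun _ => Or.inl hu
    · filter_upwards [Ioo_mem_nhdsGT hu] with c hc using Or.inr hc.2
  obtain ⟨c, hc, hac⟩ := (hgap.and self_mem_nhdsWithin).exists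
  exact ⟨c, hac, hc⟩

/-- In a crossing-minimum drawing, a pendant edge has at most the load of any other pendant edge
at the same vertex: otherwise its leaf could be moved next to the other leaf. -/
theorem pendant_load_le {V₁ V₂ : Type*} [Finite V₂]
    (E : Finset (V₁ × V₂)) (μ : V₁ × V₂ → ℕ) (hμ : ∀ e ∈ E, 1 ≤ μ e)
    (σ₁ : V₁ → ℝ) (σ₂ : V₂ → ℝ) (hσ₂ : Function.Injective σ₂)
    (hmin : ∀ τ₂ : V₂ → ℝ, Function.Injective τ₂ →
      wCrossNum E μ σ₁ σ₂ ≤ wCrossNum E μ σ₁ τ₂)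
    (v : V₁) (w w' : V₂) (hw' : (v, w') ∈ E)
    (hpw : ∀ e ∈ E, e.2 = w → e = (v, w))
    (hpw' : ∀ e ∈ E, e.2 = w' → e = (v, w')) :
    wLoad E μ σ₁ σ₂ (v, w') ≤ wLoad E μ σ₁ σ₂ (v, w) := by
  obtain ⟨c, hac, hc⟩ := exists_gap_right σ₂ (σ₂ w)
  have hne : ∀ u, σ₂ u ≠ c := fun u hu => by
    rcases hc u with h | h <;> linarith
  set τ₂ := Function.update σ₂ w' c with hτ
  have hτw' : τ₂ w' = c := Function.update_self ..
  have hτne : ∀ u, u ≠ w' → τ₂ u = σ₂ u := fun u hu => Function.update_of_ne hu ..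
  have hinj : Function.Injective τ₂ := by
    intro x y hxy
    by_cases hx : x = w' <;> by_cases hy : y = w'
    · rw [hx, hy]
    · rw [hx, hτw', hτne y hy] at hxy
      exact absurd hxy.symm (hne y)
    · rw [hy, hτw', hτne x hx] at hxy
      exact absurd hxy (hne x)
    · rw [hτne x hx, hτne y hy] at hxy
      exact hσ₂ hxy
  have hload : wLoad E μ σ₁ τ₂ (v, w') = wLoad E μ σ₁ σ₂ (v, w) := by
    refine sum_congr (filter_congr fun f hf => ?_) fun _ _ => rfl
    by_cases hfw' : f.2 = w'
    · simp [Cross2, hpw' f hf hfw']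
    by_cases hfw : f.2 = w
    · simp [Cross2, hpw f hf hfw]
    have hlt : σ₂ f.2 < c ↔ σ₂ f.2 < σ₂ w :=
      ⟨fun h => lt_of_le_of_ne ((hc f.2).resolve_right h.not_gt) fun h => hfw (hσ₂ h),
        fun h => h.trans hac⟩
    have hgt : c < σ₂ f.2 ↔ σ₂ w < σ₂ f.2 :=
      ⟨hac.trans, fun h => (hc f.2).resolve_left h.not_ge⟩
    simp only [Cross2, hτw', hτne _ hfw', hlt, hgt]
  have hrest : wCrossNum (E.erase (v, w')) μ σ₁ τ₂ = wCrossNum (E.erase (v, w')) μ σ₁ σ₂ :=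
    wCrossNum_congr _ _ _ fun e he =>
      hτne _ fun h => (mem_erase.1 he).1 (hpw' e (mem_erase.1 he).2 h)
  have hle := hmin τ₂ hinj
  rw [wCrossNum_eq_erase_add E μ σ₁ σ₂ hw', wCrossNum_eq_erase_add E μ σ₁ τ₂ hw', hrest,
    hload] at hle
  exact Nat.le_of_mul_le_mul_left (Nat.le_of_add_le_add_left hle) (hμ _ hw')

/-- In a crossing-minimum drawing, the loads of two pendant edges at the same
vertex coincide. -/
theorem pendant_loads_equal {V₁ V₂ : Type*} [Fintype V₁] [Fintype V₂]
    (E : Finset (V₁ × V₂)) (μ : V₁ × V₂ → ℕ) (hμ : ∀ e ∈ E, 1 ≤ μ e)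
    (σ₁ : V₁ → ℝ) (σ₂ : V₂ → ℝ)
    (hσ₁ : Function.Injective σ₁) (hσ₂ : Function.Injective σ₂)
    (hmin : ∀ (τ₁ : V₁ → ℝ) (τ₂ : V₂ → ℝ), Function.Injective τ₁ →
      Function.Injective τ₂ → wCrossNum E μ σ₁ σ₂ ≤ wCrossNum E μ τ₁ τ₂)
    (v : V₁) (w w' : V₂) (hww' : w ≠ w')
    (hw : (v, w) ∈ E) (hw' : (v, w') ∈ E)
    (hpw : ∀ e ∈ E, e.2 = w → e = (v, w))
    (hpw' : ∀ e ∈ E, e.2 = w' → e = (v, w')) :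
    wLoad E μ σ₁ σ₂ (v, w) = wLoad E μ σ₁ σ₂ (v, w') := by
  have hmin₂ := fun τ₂ h => hmin σ₁ τ₂ hσ₁ h
  exact le_antisymm
    (pendant_load_le E μ hμ σ₁ σ₂ hσ₂ hmin₂ v w' w hw hpw' hpw)
    (pendant_load_le E μ hμ σ₁ σ₂ hσ₂ hmin₂ v w w' hw' hpw hpw')
end

section
/- Let σ be a 2-layer drawing of a 2-layer graph (V₁,V₂,E). Let v ∈ V₁ and let uˡ, u, u', uʳ ∈ V₂ be vertices with (v,uˡ), (v,u), (v,u'), (v,uʳ) ∈ E and σ₂(uˡ) ≤ σ₂(u) < σ₂(u') ≤ σ₂(uʳ). Suppose that no vertex y ∈ V₂ with σ₂(u) ≤ σ₂(y) ≤ σ₂(u') is an endpoint of an edge of E that crosses (v,uˡ) or crosses (v,uʳ). Then an edge of E crosses (v,u) if and only if it crosses (v,u'); that is, (v,u) and (v,u') cross exactly the same set of edges in σ. -/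
/-- If no edge with an endpoint between `u` and `u'` crosses the extreme star edges,
then the two middle star edges `(v, u)` and `(v, u')` cross the same set of edges. -/
theorem middle_star_edges_same_crossings {V₁ V₂ : Type*}
    (E : Finset (V₁ × V₂)) (σ₁ : V₁ → ℝ) (σ₂ : V₂ → ℝ)
    (hσ₁ : Function.Injective σ₁) (hσ₂ : Function.Injective σ₂)
    (v : V₁) (ul u u' ur : V₂)
    (hul : (v, ul) ∈ E) (hu : (v, u) ∈ E) (hu' : (v, u') ∈ E) (hur : (v, ur) ∈ E)
    (h₁ : σ₂ ul ≤ σ₂ u) (h₂ : σ₂ u < σ₂ u') (h₃ : σ₂ u' ≤ σ₂ ur)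
    (hno : ∀ e ∈ E, σ₂ u ≤ σ₂ e.2 → σ₂ e.2 ≤ σ₂ u' →
      ¬ Cross2 σ₁ σ₂ (v, ul) e ∧ ¬ Cross2 σ₁ σ₂ (v, ur) e) :
    ∀ e ∈ E, (Cross2 σ₁ σ₂ (v, u) e ↔ Cross2 σ₁ σ₂ (v, u') e) := by
  intro e he
  have hno := hno e he
  simp only [Cross2] at hno ⊢
  grind
end

section
/- Let σ be a 2-layer drawing of a 2-layer graph (V₁,V₂,E). Let s, x₁, y₁, x₂, y₂ ∈ V₁ and let w₁, w₂ ∈ V₂ be distinct vertices such that (xᵢ,wᵢ) ∈ E and (yᵢ,wᵢ) ∈ E for i ∈ {1,2}, with σ₁(x₁) < σ₁(s) < σ₁(y₁) and σ₁(x₂) < σ₁(s) < σ₁(y₂). Then some edge among (x₁,w₁), (y₁,w₁) crosses in σ some edge among (x₂,w₂), (y₂,w₂). -/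
/-- Two cherries surrounding the same vertex `s` must produce a crossing. -/
theorem surrounding_cherries_cross {V₁ V₂ : Type*}
    (E : Finset (V₁ × V₂)) (σ₁ : V₁ → ℝ) (σ₂ : V₂ → ℝ)
    (hσ₁ : Function.Injective σ₁) (hσ₂ : Function.Injective σ₂)
    (s x₁ y₁ x₂ y₂ : V₁) (w₁ w₂ : V₂) (hw : w₁ ≠ w₂)
    (hx₁ : (x₁, w₁) ∈ E) (hy₁ : (y₁, w₁) ∈ E)
    (hx₂ : (x₂, w₂) ∈ E) (hy₂ : (y₂, w₂) ∈ E)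
    (ho₁ : σ₁ x₁ < σ₁ s) (ho₂ : σ₁ s < σ₁ y₁)
    (ho₃ : σ₁ x₂ < σ₁ s) (ho₄ : σ₁ s < σ₁ y₂) :
    ∃ e ∈ ({(x₁, w₁), (y₁, w₁)} : Set (V₁ × V₂)),
      ∃ f ∈ ({(x₂, w₂), (y₂, w₂)} : Set (V₁ × V₂)),
        Cross2 σ₁ σ₂ e f := by
  rcases (hσ₂.ne hw).lt_or_gt with h | h
  · exact ⟨(y₁, w₁), by simp, (x₂, w₂), by simp, Or.inr ⟨ho₃.trans ho₂, h⟩⟩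
  · exact ⟨(x₁, w₁), by simp, (y₂, w₂), by simp, Or.inl ⟨ho₁.trans ho₄, h⟩⟩
end

section
/- Let k be a natural number and let G be a bipartite graph with bipartition (V₁,V₂) of its vertex set that contains a cycle with at least 2k+4 vertices. Then every 2-layer drawing of G respecting (V₁,V₂) has at least k+1 crossings. -/
open Finset
open scoped Classical

/-- Let `x₁` be adjacent in `E` to `yq`. Removing `x₁` and moving the edge from `x` to `yq`
over to a lower vertex `yp` destroys at least one crossing. -/
lemma crossNum_contract_lt {V₁ V₂ : Type*} (E E' : Finset (V₁ × V₂))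
    (σ₁ : V₁ → ℝ) (σ₂ : V₂ → ℝ) (hσ₂ : Function.Injective σ₂)
    (x₁ x x' : V₁) (yp yq : V₂) (hy : σ₂ yp < σ₂ yq) (hx' : σ₁ x₁ < σ₁ x')
    (h₁ : (x₁, yq) ∈ E) (h₂ : (x, yq) ∈ E) (h₃ : (x', yp) ∈ E)
    (hsub : ∀ e ∈ E', e ∈ E ∨ e = (x, yp))
    (hfst : ∀ e ∈ E', σ₁ x₁ < σ₁ e.1) (hsnd : ∀ e ∈ E', e.2 ≠ yq) :
    crossNum E' σ₁ σ₂ < crossNum E σ₁ σ₂ := by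
  let φ : (V₁ × V₂) × (V₁ × V₂) → (V₁ × V₂) × (V₁ × V₂) := fun p =>
    if p.2 = (x, yp) then
      if σ₂ p.1.2 < σ₂ yq then ((x₁, yq), p.1) else (p.1, (x, yq))
    else if p.1 = (x, yp) then ((x, yq), p.2) else p
  have hlost : ((x₁, yq), (x', yp)) ∈
      (E ×ˢ E).filter (fun p => σ₁ p.1.1 < σ₁ p.2.1 ∧ σ₂ p.2.2 < σ₂ p.1.2) := by
    simp [h₁, h₃, hx', hy]
  unfold crossNum
  rw [← Finset.card_erase_add_one hlost, Nat.lt_succ_iff]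
  refine Finset.card_le_card_of_injOn φ ?_ ?_
  · rintro ⟨⟨u, v⟩, ⟨w, z⟩⟩ hp
    simp only [Finset.coe_filter, Finset.mem_product, Set.mem_ofPred_eq] at hp
    obtain ⟨⟨he, hf⟩, hlt, hlt'⟩ := hp
    have e1 := hsub _ he
    have f1 := hsub _ hf
    have e2 := hfst _ he
    have f2 := hfst _ hf
    have e3 := hsnd _ he
    have f3 := hsnd _ hf
    have e4 : σ₂ v ≠ σ₂ yq := fun h => e3 (hσ₂ h)
    simp only [Finset.coe_erase, Finset.coe_filter, Finset.mem_product, Set.mem_sdiff,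
      Set.mem_ofPred_eq, Set.mem_singleton_iff, φ]
    grind
  · rintro ⟨⟨u, v⟩, ⟨w, z⟩⟩ hp ⟨⟨u', v'⟩, ⟨w', z'⟩⟩ hp' heq
    simp only [Finset.coe_filter, Finset.mem_product, Set.mem_ofPred_eq] at hp hp'
    obtain ⟨⟨he, hf⟩, hlt, hlt'⟩ := hp
    obtain ⟨⟨he', hf'⟩, hltt, hltt'⟩ := hp'
    have e2 := hfst _ he
    have f2 := hfst _ hf
    have e3 := hsnd _ he
    have f3 := hsnd _ hf
    have e2' := hfst _ he'
    have f2' := hfst _ hf'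
    have e3' := hsnd _ he'
    have f3' := hsnd _ hf'
    simp only [φ] at heq
    grind

/-- A closed walk alternating between `n + 1` distinct vertices of each layer forces `n`
crossings. -/
lemma le_crossNum_of_cycle {V₁ V₂ : Type*} (σ₁ : V₁ → ℝ) (σ₂ : V₂ → ℝ)
    (hσ₁ : Function.Injective σ₁) (hσ₂ : Function.Injective σ₂) (n : ℕ) :
    ∀ (E : Finset (V₁ × V₂)) (a : Fin (n + 1) → V₁) (b : Fin (n + 1) → V₂),
      Function.Injective a → Function.Injective b →
      (∀ i, (a i, b i) ∈ E) → (∀ i, (a (i + 1), b i) ∈ E) → n ≤ crossNum E σ₁ σ₂ := by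
  induction n with
  | zero => intros; exact Nat.zero_le _
  | succ n ih =>
    intro E a₀ b₀ ha₀ hb₀ hE₁ hE₂
    obtain ⟨s, hs⟩ := Finite.exists_min (fun i => σ₁ (a₀ i))
    -- rotate the cycle so that the lowest vertex of the first layer comes last
    obtain ⟨a, hadef⟩ : ∃ a : Fin (n + 2) → V₁, ∀ i, a i = a₀ (i + (s - Fin.last _)) :=
      ⟨_, fun _ => rfl⟩
    obtain ⟨b, hbdef⟩ : ∃ b : Fin (n + 2) → V₂, ∀ i, b i = b₀ (i + (s - Fin.last _)) :=
      ⟨_, fun _ => rfl⟩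
    have ha : Function.Injective a := fun i j h => by
      rw [hadef, hadef] at h
      exact add_right_cancel (ha₀ h)
    have hb : Function.Injective b := fun i j h => by
      rw [hbdef, hbdef] at h
      exact add_right_cancel (hb₀ h)
    have hab : ∀ i, (a i, b i) ∈ E := fun i => by
      rw [hadef, hbdef]
      exact hE₁ _
    have hab' : ∀ i, (a (i + 1), b i) ∈ E := fun i => by
      rw [hadef, hbdef, add_right_comm]
      exact hE₂ _
    have hmin : ∀ i : Fin (n + 1), σ₁ (a (Fin.last _)) < σ₁ (a i.castSucc) := fun i => by
      refine lt_of_le_of_ne ?_ fun h => ?_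
      · rw [hadef, hadef, add_sub_cancel]
        exact hs _
      · exact (Fin.castSucc_lt_last i).ne' (ha (hσ₁ h))
    have hab'_cast : ∀ i : Fin (n + 1), (a i.succ, b i.castSucc) ∈ E := fun i => by
      rw [← Fin.coeSucc_eq_succ]
      exact hab' _
    have hab'_last : (a 0, b (Fin.last _)) ∈ E := by
      simpa using hab' (Fin.last _)
    have key : ∀ (yp yq : V₂) (x x' : Fin (n + 1)), σ₂ yp < σ₂ yq →
        (a (Fin.last _), yq) ∈ E → (a x.castSucc, yq) ∈ E → (a x'.castSucc, yp) ∈ E →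
        (x = 0 ∧ x' = Fin.last n ∨ x = Fin.last n ∧ x' = 0) →
        (∀ i : Fin (n + 1), i ≠ Fin.last n → b i.castSucc ≠ yp ∧ b i.castSucc ≠ yq) →
        n + 1 ≤ crossNum E σ₁ σ₂ := by
      intro yp yq x x' hy h₁ h₂ h₃ hx hb'
      let a' : Fin (n + 1) → V₁ := fun i => a i.castSucc
      let b' : Fin (n + 1) → V₂ := fun i => if i = Fin.last n then yp else b i.castSucc
      let E' : Finset (V₁ × V₂) := Finset.univ.image (fun i => (a' i, b' i)) ∪
        Finset.univ.image (fun i => (a' (i + 1), b' i))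
      have hmem : ∀ e ∈ E', ∃ i j : Fin (n + 1), e = (a' j, b' i) ∧ (j = i ∨ j = i + 1) := by
        intro e he
        simp only [E', Finset.mem_union, Finset.mem_image, Finset.mem_univ, true_and] at he
        rcases he with ⟨i, rfl⟩ | ⟨i, rfl⟩
        · exact ⟨i, i, rfl, Or.inl rfl⟩
        · exact ⟨i, i + 1, rfl, Or.inr rfl⟩
      have hn : n ≤ crossNum E' σ₁ σ₂ := by
        refine ih E' a' b' (ha.comp (Fin.castSucc_injective _)) ?_ ?_ ?_
        · intro i j hij
          have hinj : b i.castSucc = b j.castSucc → i = j :=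
            fun h => Fin.castSucc_injective _ (hb h)
          have := hb' i
          have := hb' j
          simp only [b'] at hij
          grind
        · intro i
          simp only [E', Finset.mem_union, Finset.mem_image, Finset.mem_univ, true_and]
          exact Or.inl ⟨i, rfl⟩
        · intro i
          simp only [E', Finset.mem_union, Finset.mem_image, Finset.mem_univ, true_and]
          exact Or.inr ⟨i, rfl⟩
      refine Nat.succ_le_of_lt (lt_of_le_of_lt hn ?_)
      refine crossNum_contract_lt E E' σ₁ σ₂ hσ₂ _ _ _ yp yq hy (hmin x') h₁ h₂ h₃ ?_ ?_ ?_
      · intro e he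
        obtain ⟨i, j, rfl, hj⟩ := hmem e he
        by_cases hi : i = Fin.last n
        · subst hi
          rw [Fin.last_add_one] at hj
          simp only [a', b', if_true]
          have : j = x ∨ j = x' := by grind
          rcases this with rfl | rfl
          · exact Or.inr rfl
          · exact Or.inl h₃
        · simp only [a', b', if_neg hi]
          left
          rcases hj with rfl | rfl
          · exact hab _
          · have := hab' i.castSucc
            rw [Fin.coeSucc_eq_succ] at this
            convert this using 3
            ext
            simp [Fin.val_add_one, hi]
      · intro e he
        obtain ⟨i, j, rfl, -⟩ := hmem e he
        exact hmin j
      · intro e he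
        obtain ⟨i, j, rfl, -⟩ := hmem e he
        simp only [b']
        split_ifs with hi
        · exact fun h => hy.ne (congrArg σ₂ h)
        · exact (hb' i hi).2
    have hlast : b (Fin.last n).castSucc ≠ b (Fin.last (n + 1)) :=
      fun h => (Fin.castSucc_lt_last _).ne (hb h)
    have hne : ∀ i : Fin (n + 1), i ≠ Fin.last n →
        b i.castSucc ≠ b (Fin.last n).castSucc ∧ b i.castSucc ≠ b (Fin.last (n + 1)) :=
      fun i hi => ⟨fun h => hi (Fin.castSucc_injective _ (hb h)),
        fun h => (Fin.castSucc_lt_last _).ne (hb h)⟩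
    rcases lt_or_gt_of_ne (fun h => hlast (hσ₂ h)) with h | h
    · exact key _ _ 0 (Fin.last n) h (hab _) hab'_last (hab _) (Or.inl ⟨rfl, rfl⟩) hne
    · exact key _ _ (Fin.last n) 0 h (hab'_cast (Fin.last n)) (hab _) hab'_last
        (Or.inr ⟨rfl, rfl⟩) fun i hi => (hne i hi).symm

/-- A bipartite graph containing a cycle with at least `2k + 4` vertices has at least
`k + 1` crossings in every 2-layer drawing. -/
theorem long_cycle_forces_crossings {V₁ V₂ : Type*} [Fintype V₁] [Fintype V₂]
    (E : Finset (V₁ × V₂)) (k m : ℕ) [NeZero m] (hm : k + 2 ≤ m)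
    (a : Fin m → V₁) (b : Fin m → V₂)
    (ha : Function.Injective a) (hb : Function.Injective b)
    (hE1 : ∀ i, (a i, b i) ∈ E) (hE2 : ∀ i, (a (i + 1), b i) ∈ E)
    (σ₁ : V₁ → ℝ) (σ₂ : V₂ → ℝ)
    (hσ₁ : Function.Injective σ₁) (hσ₂ : Function.Injective σ₂) :
    k + 1 ≤ crossNum E σ₁ σ₂ := by
  obtain ⟨n, rfl⟩ : ∃ n, m = n + 1 := ⟨m - 1, by omega⟩
  have := le_crossNum_of_cycle σ₁ σ₂ hσ₁ hσ₂ n E a b ha hb hE1 hE2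
  omega
end

section
/- Let G be a 3-partite graph with vertex partition (V₁,V₂,V₃) in which every edge joins V₁ to V₂ or V₂ to V₃, and let k be a natural number. Let u ∈ V₂, let i ∈ {1,3}, and let Pᵢ(u) be the set of degree-one vertices of Vᵢ adjacent to u. Suppose |Pᵢ(u)| > k+1 and let v ∈ Pᵢ(u). Then G admits a 3-layer drawing respecting (V₁,V₂,V₃) with at most k crossings if and only if G − v admits a 3-layer drawing respecting the partition obtained by removing v from Vᵢ with at most k crossings. -/
/-- The number of crossings of a 3-layer drawing `σ` of a 3-partite graph `G` with
parts `P₁, P₂, P₃`: every unordered crossing pair of edges is counted exactly once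
(the quadruple records the two edges, each oriented from the lower to the upper layer,
and the one-sided order condition selects one ordering of the pair). -/
noncomputable def crossNum3 {V : Type*} (G : SimpleGraph V) (P₁ P₂ P₃ : Set V)
    (σ : V → ℝ) : ℕ :=
  Set.ncard {q : V × V × V × V |
    ((q.1 ∈ P₁ ∧ q.2.2.1 ∈ P₁ ∧ q.2.1 ∈ P₂ ∧ q.2.2.2 ∈ P₂) ∨
      (q.1 ∈ P₂ ∧ q.2.2.1 ∈ P₂ ∧ q.2.1 ∈ P₃ ∧ q.2.2.2 ∈ P₃)) ∧
    G.Adj q.1 q.2.1 ∧ G.Adj q.2.2.1 q.2.2.2 ∧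
    σ q.1 < σ q.2.2.1 ∧ σ q.2.2.2 < σ q.2.1}

/-- `G` admits a 3-layer drawing respecting `(P₁, P₂, P₃)` with at most `k` crossings. -/
def AdmitsDrawing {V : Type*} (G : SimpleGraph V) (P₁ P₂ P₃ : Set V) (k : ℕ) : Prop :=
  ∃ σ : V → ℝ, (Set.InjOn σ P₁ ∧ Set.InjOn σ P₂ ∧ Set.InjOn σ P₃) ∧
    crossNum3 G P₁ P₂ P₃ σ ≤ k

/-- The set of crossing pairs of edges counted by `crossNum3`. -/
def crossingSet {V : Type*} (G : SimpleGraph V) (P₁ P₂ P₃ : Set V) (σ : V → ℝ) :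
    Set (V × V × V × V) :=
  {q : V × V × V × V |
    ((q.1 ∈ P₁ ∧ q.2.2.1 ∈ P₁ ∧ q.2.1 ∈ P₂ ∧ q.2.2.2 ∈ P₂) ∨
      (q.1 ∈ P₂ ∧ q.2.2.1 ∈ P₂ ∧ q.2.1 ∈ P₃ ∧ q.2.2.2 ∈ P₃)) ∧
    G.Adj q.1 q.2.1 ∧ G.Adj q.2.2.1 q.2.2.2 ∧
    σ q.1 < σ q.2.2.1 ∧ σ q.2.2.2 < σ q.2.1}

theorem crossNum3_eq_ncard_crossingSet {V : Type*} (G : SimpleGraph V) (P₁ P₂ P₃ : Set V)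
    (σ : V → ℝ) : crossNum3 G P₁ P₂ P₃ σ = (crossingSet G P₁ P₂ P₃ σ).ncard := rfl

theorem mk_mem_crossingSet {V : Type*} {G : SimpleGraph V} {P₁ P₂ P₃ : Set V} {σ : V → ℝ}
    {a b c d : V} : (a, b, c, d) ∈ crossingSet G P₁ P₂ P₃ σ ↔
      ((a ∈ P₁ ∧ c ∈ P₁ ∧ b ∈ P₂ ∧ d ∈ P₂) ∨ (a ∈ P₂ ∧ c ∈ P₂ ∧ b ∈ P₃ ∧ d ∈ P₃)) ∧
        G.Adj a b ∧ G.Adj c d ∧ σ a < σ c ∧ σ d < σ b := Iff.rfl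

theorem crossingSet_mono {V : Type*} {G : SimpleGraph V} {P₁ P₂ P₃ Q₁ Q₂ Q₃ : Set V}
    (h₁ : Q₁ ⊆ P₁) (h₂ : Q₂ ⊆ P₂) (h₃ : Q₃ ⊆ P₃) (σ : V → ℝ) :
    crossingSet G Q₁ Q₂ Q₃ σ ⊆ crossingSet G P₁ P₂ P₃ σ := by
  rintro ⟨a, b, c, d⟩ ⟨h | h, hr⟩
  · exact ⟨Or.inl ⟨h₁ h.1, h₁ h.2.1, h₂ h.2.2.1, h₂ h.2.2.2⟩, hr⟩
  · exact ⟨Or.inr ⟨h₂ h.1, h₂ h.2.1, h₃ h.2.2.1, h₃ h.2.2.2⟩, hr⟩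

/-- Being drawable is inherited by smaller layers. -/
theorem AdmitsDrawing.mono {V : Type*} [Finite V] {G : SimpleGraph V}
    {P₁ P₂ P₃ Q₁ Q₂ Q₃ : Set V} {k : ℕ} (h₁ : Q₁ ⊆ P₁) (h₂ : Q₂ ⊆ P₂) (h₃ : Q₃ ⊆ P₃)
    (h : AdmitsDrawing G P₁ P₂ P₃ k) : AdmitsDrawing G Q₁ Q₂ Q₃ k := by
  obtain ⟨σ, ⟨i₁, i₂, i₃⟩, hk⟩ := h
  exact ⟨σ, ⟨i₁.mono h₁, i₂.mono h₂, i₃.mono h₃⟩,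
    (Set.ncard_le_ncard (crossingSet_mono h₁ h₂ h₃ σ) (Set.toFinite _)).trans hk⟩

/-- Among more pendant vertices at `u` than there are crossings, one has an uncrossed edge. -/
theorem exists_pendant_uncrossed {V : Type*} [Finite V] {G : SimpleGraph V}
    {P₁ P₂ P₃ P S : Set V} (h12 : Disjoint P₁ P₂) (h13 : Disjoint P₁ P₃) (h23 : Disjoint P₂ P₃)
    (hP : P = P₁ ∨ P = P₃) {u : V} (hu : u ∈ P₂) (hSP : S ⊆ P)
    (hS : ∀ w ∈ S, G.neighborSet w = {u}) {σ : V → ℝ}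
    (hcard : (crossingSet G P₁ P₂ P₃ σ).ncard < S.ncard) :
    ∃ w ∈ S, ∀ a b c d, (a, b, c, d) ∈ crossingSet G P₁ P₂ P₃ σ →
      a ≠ w ∧ b ≠ w ∧ c ≠ w ∧ d ≠ w := by
  by_contra! hcon
  have hex : ∀ w ∈ S, ∃ q : V × V × V × V, q ∈ crossingSet G P₁ P₂ P₃ σ ∧
      (q.1 = w ∨ q.2.1 = w ∨ q.2.2.1 = w ∨ q.2.2.2 = w) := by
    intro w hw
    obtain ⟨a, b, c, d, hq, hne⟩ := hcon w hw
    exact ⟨(a, b, c, d), hq, by grind⟩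
  choose! f hf hfw using hex
  refine hcard.not_ge (Set.ncard_le_ncard_of_injOn f hf ?_ (Set.toFinite _))
  intro w hw w' hw' heq
  have hq := hf w hw
  have h₁ := hfw w hw
  have h₂ := hfw w' hw'
  rw [← heq] at h₂
  generalize f w = q at hq h₁ h₂
  obtain ⟨a, b, c, d⟩ := q
  obtain ⟨hl, hab, hcd, hac, hdb⟩ := mk_mem_crossingSet.1 hq
  have hadj : ∀ w ∈ S, ∀ x, G.Adj w x → x = u := fun w hw x hx => by
    have : x ∈ G.neighborSet w := hx
    rwa [hS w hw] at this
  have hba := hab.symm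
  have hdc := hcd.symm
  have hwP := hSP hw
  have hwP' := hSP hw'
  rw [Set.disjoint_left] at h12 h13 h23
  simp only at h₁ h₂
  rcases hP with rfl | rfl <;> grind

/-- A drawing with the pendant vertex `v` deleted extends to `v`, without new crossings, by
inserting `v` right after a pendant vertex `w` at the same vertex `u` whose edge is uncrossed. -/
theorem exists_extend_drawing {V : Type*} [Finite V] [DecidableEq V] {G : SimpleGraph V}
    {P₁ P₂ P₃ P : Set V} (h12 : Disjoint P₁ P₂) (h13 : Disjoint P₁ P₃) (h23 : Disjoint P₂ P₃)
    (hP : P = P₁ ∨ P = P₃) {u v w : V} (hu : u ∈ P₂) (hv : v ∈ P) (hw : w ∈ P) (hwv : w ≠ v)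
    (hvpend : G.neighborSet v = {u}) (hwpend : G.neighborSet w = {u}) {σ : V → ℝ}
    (i₁ : Set.InjOn σ (P₁ \ {v})) (i₂ : Set.InjOn σ (P₂ \ {v})) (i₃ : Set.InjOn σ (P₃ \ {v}))
    (hunc : ∀ a b c d, (a, b, c, d) ∈ crossingSet G (P₁ \ {v}) (P₂ \ {v}) (P₃ \ {v}) σ →
      a ≠ w ∧ b ≠ w ∧ c ≠ w ∧ d ≠ w) :
    ∃ τ : V → ℝ, (Set.InjOn τ P₁ ∧ Set.InjOn τ P₂ ∧ Set.InjOn τ P₃) ∧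
      crossingSet G P₁ P₂ P₃ τ ⊆ crossingSet G (P₁ \ {v}) (P₂ \ {v}) (P₃ \ {v}) σ := by
  obtain ⟨t, ht, hgap⟩ : ∃ t, σ w < t ∧ ∀ a, σ w < σ a → t < σ a := by
    have h : ∀ᶠ t in nhdsWithin (σ w) (Set.Ioi (σ w)), σ w < t ∧ ∀ a, σ w < σ a → t < σ a := by
      refine eventually_mem_nhdsWithin.and (Filter.eventually_all.2 fun a => ?_)
      by_cases ha : σ w < σ a
      · filter_upwards [Ioo_mem_nhdsGT ha] with t ht _ using ht.2
      · exact Filter.Eventually.of_forall fun t h => absurd h ha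
    exact h.exists
  have hvadj : ∀ x, G.Adj v x → x = u := fun x hx => by
    have : x ∈ G.neighborSet v := hx
    rwa [hvpend] at this
  have hwadj : ∀ x, G.Adj w x ↔ x = u := fun x => by
    rw [← SimpleGraph.mem_neighborSet, hwpend, Set.mem_singleton_iff]
  have hwu : G.Adj w u := (hwadj u).2 rfl
  have huw := hwu.symm
  set τ := Function.update σ v t with hτ
  have hτv : τ v = t := by simp [hτ]
  have hτne : ∀ x, x ≠ v → τ x = σ x := fun x hx => by simp [hτ, hx]
  have hne : ∀ a, σ a ≠ t := fun a ha => by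
    have := hgap a (ha ▸ ht)
    exact this.ne' ha
  have inj : ∀ Q : Set V, Set.InjOn σ (Q \ {v}) → Set.InjOn τ Q := by
    intro Q hQ x hx y hy hxy
    have := @hQ x
    by_cases hxv : x = v <;> by_cases hyv : y = v <;> grind
  refine ⟨τ, ⟨inj _ i₁, inj _ i₂, inj _ i₃⟩, ?_⟩
  rintro ⟨a, b, c, d⟩ hq
  obtain ⟨hl, hab, hcd, hac, hdb⟩ := mk_mem_crossingSet.1 hq
  have hba := hab.symm
  have hdc := hcd.symm
  rw [Set.disjoint_left] at h12 h13 h23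
  simp only [mk_mem_crossingSet, Set.mem_sdiff, Set.mem_singleton_iff] at hunc ⊢
  have key : a ≠ v ∧ b ≠ v ∧ c ≠ v ∧ d ≠ v := by
    have hright : ∀ x, x ≠ v → t < τ x → σ w < σ x := fun x hx h =>
      ht.trans (hτne x hx ▸ h)
    have hleft : ∀ x ∈ P, x ≠ v → τ x < t → x = w ∨ σ x < σ w := by
      intro x hx hxv h
      rw [hτne x hxv] at h
      have hle : σ x ≤ σ w := not_lt.1 fun h' => (hgap x h').not_gt h
      have hinj : Set.InjOn σ (P \ {v}) := hP.elim (fun e => e ▸ i₁) (fun e => e ▸ i₃)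
      exact hle.lt_or_eq.symm.imp_left fun e => hinj ⟨hx, hxv⟩ ⟨hw, hwv⟩ e
    have huv : u ≠ v := by rcases hP with rfl | rfl <;> grind
    clear_value τ
    clear inj hgap hne i₁ i₂ i₃ hτ
    rcases hP with rfl | rfl
    · have hv₂ := h12 hv
      have hv₃ := h13 hv
      have h₁ := hunc w u c d
      have h₂ := hunc a b w u
      clear hunc
      rcases hl with ⟨ha, hc, hb, hd⟩ | ⟨ha, hc, hb, hd⟩
      · have hbv : b ≠ v := fun h => hv₂ (h ▸ hb)
        have hdv : d ≠ v := fun h => hv₂ (h ▸ hd)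
        rw [hτne b hbv, hτne d hdv] at hdb
        refine ⟨?_, hbv, ?_, hdv⟩ <;> rintro rfl
        · obtain rfl := hvadj _ hab
          have hca : c ≠ a := by grind
          exact (h₁ ⟨Or.inl ⟨⟨hw, hwv⟩, ⟨hc, hca⟩, ⟨hu, huv⟩, hd, hdv⟩, hwu, hcd,
            hright c hca (hτv ▸ hac), hdb⟩).1 rfl
        · obtain rfl := hvadj _ hcd
          have hac' : a ≠ c := by grind
          rcases hleft a ha hac' (hτv ▸ hac) with rfl | hlt
          · exact hdb.ne' (congrArg σ ((hwadj b).1 hab))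
          · exact (h₂ ⟨Or.inl ⟨⟨ha, hac'⟩, ⟨hw, hwv⟩, ⟨hb, hbv⟩, hu, huv⟩, hab, hwu,
              hlt, hdb⟩).2.2.1 rfl
      · grind
    · have hv₁ : v ∉ P₁ := fun h => h13 h hv
      have hv₂ : v ∉ P₂ := fun h => h23 h hv
      have h₁ := hunc u w c d
      have h₂ := hunc a b u w
      clear hunc
      rcases hl with ⟨ha, hc, hb, hd⟩ | ⟨ha, hc, hb, hd⟩
      · grind
      · have hav : a ≠ v := fun h => hv₂ (h ▸ ha)
        have hcv : c ≠ v := fun h => hv₂ (h ▸ hc)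
        rw [hτne a hav, hτne c hcv] at hac
        refine ⟨hav, ?_, hcv, ?_⟩ <;> rintro rfl
        · obtain rfl := hvadj _ hba
          have hdv : d ≠ b := by grind
          rcases hleft d hd hdv (hτv ▸ hdb) with rfl | hlt
          · exact hac.ne' (congrArg σ ((hwadj c).1 hdc))
          · exact (h₁ ⟨Or.inr ⟨⟨hu, huv⟩, ⟨hc, hcv⟩, ⟨hw, hwv⟩, hd, hdv⟩, huw, hcd,
              hac, hlt⟩).2.1 rfl
        · obtain rfl := hvadj _ hdc
          have hbv : b ≠ d := by grind
          exact (h₂ ⟨Or.inr ⟨⟨ha, hav⟩, ⟨hu, huv⟩, ⟨hb, hbv⟩, hw, hwv⟩, hab, huw,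
            hac, hright b hbv (hτv ▸ hdb)⟩).2.2.2 rfl
  obtain ⟨ha, hb, hc, hd⟩ := key
  rw [hτne _ ha, hτne _ hc] at hac
  rw [hτne _ hd, hτne _ hb] at hdb
  exact ⟨by grind, hab, hcd, hac, hdb⟩

/-- Deleting one of more than `k + 1` pendant vertices attached to the same vertex `u`
of the middle layer preserves `k`-drawability. -/
theorem pendant_vertex_reduction {V : Type*} [Fintype V] [DecidableEq V]
    (G : SimpleGraph V) (P₁ P₂ P₃ : Set V)
    (hcov : P₁ ∪ P₂ ∪ P₃ = Set.univ)
    (h12 : Disjoint P₁ P₂) (h13 : Disjoint P₁ P₃) (h23 : Disjoint P₂ P₃)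
    (hedge : ∀ a b : V, G.Adj a b →
      (a ∈ P₁ ∧ b ∈ P₂) ∨ (a ∈ P₂ ∧ b ∈ P₁) ∨ (a ∈ P₂ ∧ b ∈ P₃) ∨ (a ∈ P₃ ∧ b ∈ P₂))
    (k : ℕ) (u : V) (hu : u ∈ P₂)
    (P : Set V) (hP : P = P₁ ∨ P = P₃)
    (hmany : k + 1 < Set.ncard {w : V | w ∈ P ∧ G.neighborSet w = {u}})
    (v : V) (hv : v ∈ P) (hvpend : G.neighborSet v = {u}) :
    AdmitsDrawing G P₁ P₂ P₃ k ↔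
      AdmitsDrawing G (P₁ \ {v}) (P₂ \ {v}) (P₃ \ {v}) k := by
  refine ⟨AdmitsDrawing.mono Set.sdiff_subset Set.sdiff_subset Set.sdiff_subset, ?_⟩
  rintro ⟨σ, ⟨i₁, i₂, i₃⟩, hk⟩
  rw [crossNum3_eq_ncard_crossingSet] at hk
  set W := {w : V | w ∈ P ∧ G.neighborSet w = {u}} with hW
  have hcard : k < (W \ {v}).ncard := by
    rw [Set.ncard_sdiff_singleton_of_mem (show v ∈ W from ⟨hv, hvpend⟩)]
    omega
  have huv : u ≠ v := by
    rintro rfl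
    exact hP.elim (fun h => Set.disjoint_left.1 h12 (h ▸ hv) hu)
      fun h => Set.disjoint_left.1 h23 hu (h ▸ hv)
  obtain ⟨w, ⟨hwW, hwv⟩, hunc⟩ := exists_pendant_uncrossed (P := P \ {v}) (S := W \ {v})
    (h12.mono Set.sdiff_subset Set.sdiff_subset) (h13.mono Set.sdiff_subset Set.sdiff_subset)
    (h23.mono Set.sdiff_subset Set.sdiff_subset)
    (hP.imp (fun h => h ▸ rfl) (fun h => h ▸ rfl)) (u := u) ⟨hu, huv⟩
    (Set.sdiff_subset_sdiff_left fun w hw => hw.1) (fun w hw => hw.1.2) (hk.trans_lt hcard)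
  obtain ⟨τ, hinj, hsub⟩ := exists_extend_drawing h12 h13 h23 hP hu hv hwW.1 hwv hvpend hwW.2
    i₁ i₂ i₃ hunc
  exact ⟨τ, hinj, (Set.ncard_le_ncard hsub (Set.toFinite _)).trans hk⟩
end

section
/- Let G be a 3-partite graph with vertex partition (V₁,V₂,V₃) in which every edge joins V₁ to V₂ or V₂ to V₃, let k be a natural number, and let u ∈ V₁. Call a connected component H of G − u nice if V(H) ⊆ V₂ ∪ V₃ and H admits a 2-layer drawing respecting (V₂ ∩ V(H), V₃ ∩ V(H)) with no crossings. Suppose that G − u has at least 2k+2 nice connected components, that every nice connected component of G − u contains a vertex adjacent to u in G, and that H is a nice connected component chosen so that H consists of a single vertex whenever some nice connected component of G − u consists of a single vertex. Then G admits a 3-layer drawing respecting (V₁,V₂,V₃) with at most k crossings if and only if G − V(H) admits a 3-layer drawing respecting the induced partition (V₁, V₂∖V(H), V₃∖V(H)) with at most k crossings. -/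
/-- The vertex set (in `V`) of a connected component of `G - u`. -/
def compVerts {V : Type*} (G : SimpleGraph V) (u : V)
    (c : (G.induce {w | w ≠ u}).ConnectedComponent) : Set V :=
  {y : V | ∃ hy : y ≠ u, (G.induce {w | w ≠ u}).connectedComponentMk ⟨y, hy⟩ = c}

/-- A connected component of `G - u` is nice if its vertices lie in `P₂ ∪ P₃` and it
admits a crossing-free 2-layer drawing respecting `(P₂ ∩ V(H), P₃ ∩ V(H))`. -/
def NiceComponent {V : Type*} (G : SimpleGraph V) (P₂ P₃ : Set V) (u : V)
    (c : (G.induce {w | w ≠ u}).ConnectedComponent) : Prop :=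
  compVerts G u c ⊆ P₂ ∪ P₃ ∧
    ∃ τ : V → ℝ, Set.InjOn τ (P₂ ∩ compVerts G u c) ∧
      Set.InjOn τ (P₃ ∩ compVerts G u c) ∧
      ∀ a a' b b' : V, a ∈ P₂ ∩ compVerts G u c → a' ∈ P₂ ∩ compVerts G u c →
        b ∈ P₃ ∩ compVerts G u c → b' ∈ P₃ ∩ compVerts G u c →
        G.Adj a b → G.Adj a' b' → ¬(τ a < τ a' ∧ τ b' < τ b)

/-- The set of crossings counted by `crossNum3`. -/
def crossings {V : Type*} (G : SimpleGraph V) (P₁ P₂ P₃ : Set V) (σ : V → ℝ) :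
    Set (V × V × V × V) :=
  {q | ((q.1 ∈ P₁ ∧ q.2.2.1 ∈ P₁ ∧ q.2.1 ∈ P₂ ∧ q.2.2.2 ∈ P₂) ∨
      (q.1 ∈ P₂ ∧ q.2.2.1 ∈ P₂ ∧ q.2.1 ∈ P₃ ∧ q.2.2.2 ∈ P₃)) ∧
    G.Adj q.1 q.2.1 ∧ G.Adj q.2.2.1 q.2.2.2 ∧
    σ q.1 < σ q.2.2.1 ∧ σ q.2.2.2 < σ q.2.1}

/-- The vertices of `S` admit a crossing-free 2-layer drawing respecting
`(P₂ ∩ S, P₃ ∩ S)`. -/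
def PlanarOn {V : Type*} (G : SimpleGraph V) (P₂ P₃ S : Set V) (τ : V → ℝ) : Prop :=
  Set.InjOn τ (P₂ ∩ S) ∧ Set.InjOn τ (P₃ ∩ S) ∧
    ∀ a a' b b' : V, a ∈ P₂ ∩ S → a' ∈ P₂ ∩ S → b ∈ P₃ ∩ S → b' ∈ P₃ ∩ S →
      G.Adj a b → G.Adj a' b' → ¬(τ a < τ a' ∧ τ b' < τ b)

/-- A map from a finite type to a linear order can be replaced by a real-valued map
inducing the same order. -/
theorem exists_real_lt_iff {V L : Type*} [Finite V] [LinearOrder L] (f : V → L) :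
    ∃ σ : V → ℝ, ∀ x y, σ x < σ y ↔ f x < f y := by
  have mono : ∀ x y, f x ≤ f y → {z | f z < f x}.ncard ≤ {z | f z < f y}.ncard :=
    fun x y h => Set.ncard_le_ncard (fun z hz => lt_of_lt_of_le hz h) (Set.toFinite _)
  refine ⟨fun x => (Set.ncard {z | f z < f x} : ℝ), fun x y => ?_⟩
  rw [Nat.cast_lt]
  constructor
  · intro h
    by_contra! h'
    exact absurd h (mono y x h').not_gt
  · intro h
    refine Set.ncard_lt_ncard ⟨fun z hz => lt_trans hz h, fun hsub => ?_⟩ (Set.toFinite _)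
    exact lt_irrefl _ (hsub h : f x < f x)

theorem AdmitsDrawing.diff {V : Type*} [Finite V] {G : SimpleGraph V} {P₁ P₂ P₃ : Set V}
    {k : ℕ} (h : AdmitsDrawing G P₁ P₂ P₃ k) (S : Set V) :
    AdmitsDrawing G (P₁ \ S) (P₂ \ S) (P₃ \ S) k := by
  obtain ⟨σ, ⟨h1, h2, h3⟩, hk⟩ := h
  refine ⟨σ, ⟨h1.mono Set.sdiff_subset, h2.mono Set.sdiff_subset, h3.mono Set.sdiff_subset⟩,
    le_trans (Set.ncard_le_ncard ?_ (Set.toFinite _)) hk⟩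
  rintro q ⟨hq, hr⟩
  exact ⟨hq.imp (fun ⟨a, b, c, d⟩ => ⟨a.1, b.1, c.1, d.1⟩)
    (fun ⟨a, b, c, d⟩ => ⟨a.1, b.1, c.1, d.1⟩), hr⟩

section Components

variable {V : Type*} {G : SimpleGraph V} {u : V}
  {c c' : (G.induce {w | w ≠ u}).ConnectedComponent}

theorem notMem_compVerts : u ∉ compVerts G u c := fun ⟨h, _⟩ => h rfl

theorem eq_of_mem_compVerts {x : V} (h : x ∈ compVerts G u c) (h' : x ∈ compVerts G u c') :
    c = c' := by
  obtain ⟨_, rfl⟩ := h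
  obtain ⟨_, rfl⟩ := h'
  rfl

theorem mem_compVerts_of_adj {a b : V} (ha : a ∈ compVerts G u c) (hab : G.Adj a b)
    (hb : b ≠ u) : b ∈ compVerts G u c := by
  obtain ⟨ha', rfl⟩ := ha
  refine ⟨hb, ?_⟩
  rw [SimpleGraph.ConnectedComponent.eq]
  exact SimpleGraph.Adj.reachable (G := G.induce {w | w ≠ u})
    (u := ⟨b, hb⟩) (v := ⟨a, ha'⟩) hab.symm

theorem exists_adj_of_ncard_compVerts_ne_one {v : V} (hv : v ∈ compVerts G u c)
    (hc : (compVerts G u c).ncard ≠ 1) : ∃ w ∈ compVerts G u c, G.Adj v w := by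
  have hy : ∃ y ∈ compVerts G u c, y ≠ v := by
    by_contra! h
    exact hc (Set.ncard_eq_one.2 ⟨v, Set.eq_singleton_iff_unique_mem.2 ⟨hv, h⟩⟩)
  obtain ⟨y, ⟨hyu, hy⟩, hyv⟩ := hy
  obtain ⟨hvu, hvc⟩ := id hv
  obtain ⟨p⟩ := SimpleGraph.ConnectedComponent.eq.1 (hvc.trans hy.symm)
  cases p with
  | nil => exact absurd rfl hyv
  | @cons _ w _ h _ => exact ⟨w, mem_compVerts_of_adj hv h w.2, h⟩

/-- If there are more than `2 k` components from a family `N` of components, then one of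
them is disjoint from all edges taking part in any of at most `k` given pairs of edges. -/
theorem exists_compVerts_untouched [Finite V]
    {N : Set (G.induce {w | w ≠ u}).ConnectedComponent} {X : Set (V × V × V × V)} {k : ℕ}
    (hX : X.ncard ≤ k) (hN : 2 * k < N.ncard)
    (hadj : ∀ q ∈ X, G.Adj q.1 q.2.1 ∧ G.Adj q.2.2.1 q.2.2.2) :
    ∃ c ∈ N, ∀ q ∈ X, q.1 ∉ compVerts G u c ∧ q.2.1 ∉ compVerts G u c ∧
      q.2.2.1 ∉ compVerts G u c ∧ q.2.2.2 ∉ compVerts G u c := by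
  by_contra! hcon
  have key : ∀ a b : V, G.Adj a b → ∀ c c' : (G.induce {w | w ≠ u}).ConnectedComponent,
      (a ∈ compVerts G u c ∨ b ∈ compVerts G u c) →
      (a ∈ compVerts G u c' ∨ b ∈ compVerts G u c') → c = c' := by
    intro a b hab c c' h h'
    have ne : ∀ {x : V} {d : (G.induce {w | w ≠ u}).ConnectedComponent},
      x ∈ compVerts G u d → x ≠ u := fun h => h.1
    rcases h with h | h <;> rcases h' with h' | h'
    · exact eq_of_mem_compVerts h h'
    · exact eq_of_mem_compVerts (mem_compVerts_of_adj h hab (ne h')) h'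
    · exact eq_of_mem_compVerts (mem_compVerts_of_adj h hab.symm (ne h')) h'
    · exact eq_of_mem_compVerts h h'
  have hex : ∀ c ∈ N, ∃ p : (V × V × V × V) × Bool, p.1 ∈ X ∧
      (p.2 = true → p.1.1 ∈ compVerts G u c ∨ p.1.2.1 ∈ compVerts G u c) ∧
      (p.2 = false → p.1.2.2.1 ∈ compVerts G u c ∨ p.1.2.2.2 ∈ compVerts G u c) := by
    intro c hc
    obtain ⟨q, hq, h⟩ := hcon c hc
    by_cases h1 : q.1 ∈ compVerts G u c ∨ q.2.1 ∈ compVerts G u c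
    · exact ⟨(q, true), hq, fun _ => h1, by simp⟩
    · refine ⟨(q, false), hq, by simp, fun _ => ?_⟩
      push Not at h1
      by_contra! h2
      exact h2.2 (h h1.1 h1.2 h2.1)
  have : Nonempty V := ⟨u⟩
  choose! f hfX hft hff using hex
  have hle : N.ncard ≤ (X ×ˢ (Set.univ : Set Bool)).ncard := by
    refine Set.ncard_le_ncard_of_injOn f (fun c hc => ⟨hfX c hc, trivial⟩) ?_ (Set.toFinite _)
    intro c hc c' hc' he
    obtain ⟨h1, h2⟩ := hadj _ (hfX c hc)
    cases hb : (f c).2 with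
    | true => exact key _ _ h1 c c' (hft c hc hb) (he ▸ hft c' hc' (he ▸ hb))
    | false => exact key _ _ h2 c c' (hff c hc hb) (he ▸ hff c' hc' (he ▸ hb))
  rw [Set.ncard_prod, Set.ncard_univ, Nat.card_eq_fintype_card, Fintype.card_bool] at hle
  omega

end Components

/-- Let `C` and `H` be disjoint sets of vertices of the last two layers, each planar and having
`u` as its only possible outside neighbour. If a drawing of `G - H` has no crossing meeting `C`,
then redrawing both `C` and `H` in the place of a path `u v w` with `v, w ∈ C` gives a drawing
of `G` without new crossings. -/
theorem exists_drawing_crossings_subset {V : Type*} [Finite V] {G : SimpleGraph V}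
    {P₁ P₂ P₃ C H : Set V} (h12 : Disjoint P₁ P₂) (h13 : Disjoint P₁ P₃) (h23 : Disjoint P₂ P₃)
    {u v w : V} (hu : u ∈ P₁) (hCH : Disjoint C H)
    (hC : C ⊆ P₂ ∪ P₃) (hH : H ⊆ P₂ ∪ P₃)
    (hCadj : ∀ a b, a ∈ C → G.Adj a b → b ≠ u → b ∈ C)
    (hHadj : ∀ a b, a ∈ H → G.Adj a b → b ≠ u → b ∈ H)
    {τC τH : V → ℝ} (hτC : PlanarOn G P₂ P₃ C τC) (hτH : PlanarOn G P₂ P₃ H τH)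
    (hvC : v ∈ C) (hv : v ∈ P₂) (huv : G.Adj u v)
    (hw : ∀ x ∈ C ∪ H, x ∈ P₃ → w ∈ C ∧ w ∈ P₃ ∧ G.Adj v w)
    {σ : V → ℝ} (hσ₁ : Set.InjOn σ (P₁ \ H)) (hσ₂ : Set.InjOn σ (P₂ \ H))
    (hσ₃ : Set.InjOn σ (P₃ \ H))
    (hX : ∀ q ∈ crossings G (P₁ \ H) (P₂ \ H) (P₃ \ H) σ,
      q.1 ∉ C ∧ q.2.1 ∉ C ∧ q.2.2.1 ∉ C ∧ q.2.2.2 ∉ C) :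
    ∃ ρ : V → ℝ, (Set.InjOn ρ P₁ ∧ Set.InjOn ρ P₂ ∧ Set.InjOn ρ P₃) ∧
      crossings G P₁ P₂ P₃ ρ ⊆ crossings G (P₁ \ H) (P₂ \ H) (P₃ \ H) σ := by
  classical
  let pos : V → ℝ := fun x => if x ∈ C ∪ H then (if x ∈ P₂ then σ v else σ w) else σ x
  let T : V → ℝ := fun x => if x ∈ H then τH x else τC x
  let f : V → ℝ ×ₗ ℕ ×ₗ ℝ := fun x => toLex (pos x, toLex (if x ∈ H then 1 else 0, T x))
  obtain ⟨ρ, hρ⟩ := exists_real_lt_iff f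
  have n12 : ∀ {x}, x ∈ P₁ → x ∉ P₂ := fun h h' => h12.le_bot ⟨h, h'⟩
  have n13 : ∀ {x}, x ∈ P₁ → x ∉ P₃ := fun h h' => h13.le_bot ⟨h, h'⟩
  have n23 : ∀ {x}, x ∈ P₂ → x ∉ P₃ := fun h h' => h23.le_bot ⟨h, h'⟩
  have nCH : ∀ {x}, x ∈ C → x ∉ H := fun h h' => hCH.le_bot ⟨h, h'⟩
  have nS : ∀ {x}, x ∈ P₁ → x ∉ C ∪ H := by
    rintro x hx (h | h)
    · exact (hC h).elim (n12 hx) (n13 hx)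
    · exact (hH h).elim (n12 hx) (n13 hx)
  have nH : ∀ {x}, x ∉ C ∪ H → x ∉ H := fun h h' => h (Or.inr h')
  have nC : ∀ {x}, x ∉ C ∪ H → x ∉ C := fun h h' => h (Or.inl h')
  have hS_adj : ∀ {a b}, a ∈ C ∪ H → G.Adj a b → b ≠ u → b ∈ C ∪ H := by
    rintro a b (h | h) hab hb
    · exact Or.inl (hCadj a b h hab hb)
    · exact Or.inr (hHadj a b h hab hb)
  have pos_out : ∀ {x}, x ∉ C ∪ H → pos x = σ x := fun h => if_neg h
  have pos_two : ∀ {x}, x ∈ C ∪ H → x ∈ P₂ → pos x = σ v := fun h h' => by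
    simp only [pos, if_pos h, if_pos h']
  have pos_three : ∀ {x}, x ∈ C ∪ H → x ∈ P₃ → pos x = σ w := fun h h' => by
    simp only [pos, if_pos h, if_neg (fun h2 => n23 h2 h')]
  have lt_pos : ∀ {x y}, ρ x < ρ y → pos x ≤ pos y := fun {x y} h => by
    have := (Prod.Lex.toLex_lt_toLex.1 ((hρ x y).1 h))
    exact this.elim le_of_lt (fun h => h.1.le)
  have lt_same : ∀ {x y}, ρ x < ρ y → pos x = pos y →
      (x ∉ H ∧ y ∈ H) ∨ ((x ∈ H ↔ y ∈ H) ∧ T x < T y) := fun {x y} h he => by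
    have h1 := (Prod.Lex.toLex_lt_toLex.1 ((hρ x y).1 h))
    have h2 := h1.resolve_left (by simp [he])
    have h3 := Prod.Lex.toLex_lt_toLex.1 h2.2
    by_cases hx : x ∈ H <;> by_cases hy : y ∈ H <;>
      simp [hx, hy] at h3 ⊢ <;> exact h3
  have f_eq : ∀ {x y}, ρ x = ρ y → pos x = pos y ∧ (x ∈ H ↔ y ∈ H) ∧ T x = T y :=
    fun {x y} h => by
      have h1 : f x = f y := le_antisymm (not_lt.1 fun h' => ((hρ y x).2 h').ne' h)
        (not_lt.1 fun h' => ((hρ x y).2 h').ne h)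
      have h2 : (pos x, toLex ((if x ∈ H then 1 else 0 : ℕ), T x)) =
        (pos y, toLex ((if y ∈ H then 1 else 0 : ℕ), T y)) := toLex.injective h1
      obtain ⟨h3, h4⟩ := Prod.mk.inj h2
      obtain ⟨h5, h6⟩ := Prod.mk.inj (toLex.injective h4)
      refine ⟨h3, ?_, h6⟩
      by_cases hx : x ∈ H <;> by_cases hy : y ∈ H <;> simp [hx, hy] at h5 ⊢
  have T_C : ∀ {x}, x ∉ H → T x = τC x := fun h => if_neg h
  have T_H : ∀ {x}, x ∈ H → T x = τH x := fun h => if_pos h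
  have inj_layer : ∀ {P : Set V} {z : V}, (∀ x ∈ C ∪ H, x ∈ P → pos x = σ z ∧ z ∈ C ∧ z ∈ P) →
      Set.InjOn σ (P \ H) → Set.InjOn τC (P ∩ C) → Set.InjOn τH (P ∩ H) → Set.InjOn ρ P := by
    intro P z hz hσ hiC hiH x hx y hy hxy
    obtain ⟨h1, h2, h3⟩ := f_eq hxy
    by_cases hxS : x ∈ C ∪ H <;> by_cases hyS : y ∈ C ∪ H
    · by_cases hxH : x ∈ H
      · rw [T_H hxH, T_H (h2.1 hxH)] at h3
        exact hiH ⟨hx, hxH⟩ ⟨hy, h2.1 hxH⟩ h3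
      · have hyH := fun h => hxH (h2.2 h)
        rw [T_C hxH, T_C hyH] at h3
        exact hiC ⟨hx, hxS.resolve_right hxH⟩ ⟨hy, hyS.resolve_right hyH⟩ h3
    · obtain ⟨h4, h5, h6⟩ := hz x hxS hx
      rw [h4, pos_out hyS] at h1
      exact absurd (Or.inl (hσ ⟨h6, nCH h5⟩ ⟨hy, nH hyS⟩ h1 ▸ h5)) hyS
    · obtain ⟨h4, h5, h6⟩ := hz y hyS hy
      rw [h4, pos_out hxS] at h1
      exact absurd (Or.inl (hσ ⟨hx, nH hxS⟩ ⟨h6, nCH h5⟩ h1 ▸ h5)) hxS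
    · rw [pos_out hxS, pos_out hyS] at h1
      exact hσ ⟨hx, nH hxS⟩ ⟨hy, nH hyS⟩ h1
  have hz₂ : ∀ x ∈ C ∪ H, x ∈ P₂ → pos x = σ v ∧ v ∈ C ∧ v ∈ P₂ :=
    fun x hx h => ⟨pos_two hx h, hvC, hv⟩
  have hz₃ : ∀ x ∈ C ∪ H, x ∈ P₃ → pos x = σ w ∧ w ∈ C ∧ w ∈ P₃ :=
    fun x hx h => ⟨pos_three hx h, (hw x hx h).1, (hw x hx h).2.1⟩
  have lt_layer : ∀ {P : Set V} {x y}, Set.InjOn σ (P \ H) → x ∈ P → y ∈ P → x ∉ H → y ∉ H →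
      x ≠ y → σ x ≤ σ y → σ x < σ y := fun hσ hx hy hxH hyH hne hle =>
    lt_of_le_of_ne hle (fun h => hne (hσ ⟨hx, hxH⟩ ⟨hy, hyH⟩ h))
  -- comparisons of two vertices of a layer, at least one of which lies outside `C ∪ H`
  have lt_oo : ∀ {P : Set V} {x y}, Set.InjOn σ (P \ H) → x ∈ P → y ∈ P → x ∉ C ∪ H →
      y ∉ C ∪ H → ρ x < ρ y → σ x < σ y := fun {P x y} hσ hx hy hxS hyS h => by
    have h1 := lt_pos h
    rw [pos_out hxS, pos_out hyS] at h1
    exact lt_layer hσ hx hy (nH hxS) (nH hyS) (fun e => by subst e; exact lt_irrefl _ h) h1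
  have lt_io : ∀ {P : Set V} {z x y}, Set.InjOn σ (P \ H) → pos x = σ z ∧ z ∈ C ∧ z ∈ P →
      y ∈ P → y ∉ C ∪ H → ρ x < ρ y → σ z < σ y := fun {P z x y} hσ hz hy hyS h => by
    have h1 := lt_pos h
    rw [hz.1, pos_out hyS] at h1
    exact lt_layer hσ hz.2.2 hy (nCH hz.2.1) (nH hyS) (fun e => hyS (Or.inl (e ▸ hz.2.1))) h1
  have lt_oi : ∀ {P : Set V} {z x y}, Set.InjOn σ (P \ H) → pos y = σ z ∧ z ∈ C ∧ z ∈ P →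
      x ∈ P → x ∉ C ∪ H → ρ x < ρ y → σ x < σ z := fun {P z x y} hσ hz hx hxS h => by
    have h1 := lt_pos h
    rw [hz.1, pos_out hxS] at h1
    exact lt_layer hσ hx hz.2.2 (nH hxS) (nCH hz.2.1) (fun e => hxS (Or.inl (e ▸ hz.2.1))) h1
  refine ⟨ρ, ⟨?_, inj_layer hz₂ hσ₂ hτC.1 hτH.1, inj_layer hz₃ hσ₃ hτC.2.1 hτH.2.1⟩, ?_⟩
  · intro x hx y hy hxy
    have h1 := (f_eq hxy).1
    rw [pos_out (nS hx), pos_out (nS hy)] at h1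
    exact hσ₁ ⟨hx, nH (nS hx)⟩ ⟨hy, nH (nS hy)⟩ h1
  rintro ⟨a, b, a', b'⟩ ⟨hP, hab, hab', hlt, hlt'⟩
  simp only at hP hab hab' hlt hlt'
  rcases hP with ⟨ha, ha', hb, hb'⟩ | ⟨ha, ha', hb, hb'⟩
  · have eq_u : ∀ {x y}, x ∈ P₁ → G.Adj x y → y ∈ C ∪ H → x = u := fun hx hxy hy => by
      by_contra hne
      exact nS hx (hS_adj hy hxy.symm hne)
    have hσa := lt_oo hσ₁ ha ha' (nS ha) (nS ha') hlt
    have ha1 : a ∈ P₁ \ H := ⟨ha, nH (nS ha)⟩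
    have ha1' : a' ∈ P₁ \ H := ⟨ha', nH (nS ha')⟩
    have hv2 : v ∈ P₂ \ H := ⟨hv, nCH hvC⟩
    by_cases hbS : b ∈ C ∪ H <;> by_cases hbS' : b' ∈ C ∪ H
    · rw [eq_u ha hab hbS, eq_u ha' hab' hbS'] at hσa
      exact absurd hσa (lt_irrefl _)
    · obtain rfl := eq_u ha hab hbS
      refine absurd hvC (hX (a, v, a', b') ⟨Or.inl ⟨ha1, ha1', hv2, hb', nH hbS'⟩, huv, hab', hσa,
        lt_oi hσ₂ (hz₂ b hbS hb) hb' hbS' hlt'⟩).2.1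
    · obtain rfl := eq_u ha' hab' hbS'
      refine absurd hvC (hX (a, b, a', v) ⟨Or.inl ⟨ha1, ha1', ⟨hb, nH hbS⟩, hv2⟩, hab, huv, hσa,
        lt_io hσ₂ (hz₂ b' hbS' hb') hb hbS hlt'⟩).2.2.2
    · exact ⟨Or.inl ⟨ha1, ha1', ⟨hb, nH hbS⟩, hb', nH hbS'⟩, hab, hab', hσa,
        lt_oo hσ₂ hb' hb hbS' hbS hlt'⟩
  · have ne2 : ∀ {x}, x ∈ P₂ → x ≠ u := fun h e => n12 hu (e ▸ h)
    have ne3 : ∀ {x}, x ∈ P₃ → x ≠ u := fun h e => n13 hu (e ▸ h)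
    by_cases haS : a ∈ C ∪ H <;> by_cases haS' : a' ∈ C ∪ H
    · exfalso
      have hbS := hS_adj haS hab (ne3 hb)
      have hbS' := hS_adj haS' hab' (ne3 hb')
      have hl := lt_same hlt ((pos_two haS ha).trans (pos_two haS' ha').symm)
      have hl' := lt_same hlt' ((pos_three hbS' hb').trans (pos_three hbS hb).symm)
      have i1 : a ∈ H ↔ b ∈ H :=
        ⟨fun h => hHadj _ _ h hab (ne3 hb), fun h => hHadj _ _ h hab.symm (ne2 ha)⟩
      have i2 : a' ∈ H ↔ b' ∈ H :=
        ⟨fun h => hHadj _ _ h hab' (ne3 hb'), fun h => hHadj _ _ h hab'.symm (ne2 ha')⟩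
      rcases hl with ⟨h1, h2⟩ | ⟨h1, h2⟩
      · have hbH : b ∉ H := fun h => h1 (i1.2 h)
        rcases hl' with ⟨-, h4⟩ | ⟨h3, -⟩
        · exact hbH h4
        · exact hbH (h3.1 (i2.1 h2))
      · have h4 : T b' < T b := by
          rcases hl' with ⟨h3, h4⟩ | ⟨h3, h4⟩
          · exact absurd (i2.1 (h1.1 (i1.2 h4))) h3
          · exact h4
        by_cases haH : a ∈ H
        · have haH' := h1.1 haH
          have hbH := i1.1 haH
          have hbH' := i2.1 haH'
          rw [T_H haH, T_H haH'] at h2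
          rw [T_H hbH, T_H hbH'] at h4
          exact hτH.2.2 a a' b b' ⟨ha, haH⟩ ⟨ha', haH'⟩ ⟨hb, hbH⟩ ⟨hb', hbH'⟩ hab hab' ⟨h2, h4⟩
        · have haH' := fun h => haH (h1.2 h)
          have hbH := fun h => haH (i1.2 h)
          have hbH' := fun h => haH' (i2.2 h)
          rw [T_C haH, T_C haH'] at h2
          rw [T_C hbH, T_C hbH'] at h4
          exact hτC.2.2 a a' b b' ⟨ha, haS.resolve_right haH⟩ ⟨ha', haS'.resolve_right haH'⟩
            ⟨hb, hbS.resolve_right hbH⟩ ⟨hb', hbS'.resolve_right hbH'⟩ hab hab' ⟨h2, h4⟩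
    · have hbS := hS_adj haS hab (ne3 hb)
      have hbS' : b' ∉ C ∪ H := fun h => haS' (hS_adj h hab'.symm (ne2 ha'))
      obtain ⟨hwC, hw3, hvw⟩ := hw b hbS hb
      exact absurd hvC (hX (v, w, a', b') ⟨Or.inr ⟨⟨hv, nCH hvC⟩, ⟨ha', nH haS'⟩, ⟨hw3, nCH hwC⟩,
        hb', nH hbS'⟩, hvw, hab', lt_io hσ₂ (hz₂ a haS ha) ha' haS' hlt,
        lt_oi hσ₃ (hz₃ b hbS hb) hb' hbS' hlt'⟩).1
    · have hbS' := hS_adj haS' hab' (ne3 hb')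
      have hbS : b ∉ C ∪ H := fun h => haS (hS_adj h hab.symm (ne2 ha))
      obtain ⟨hwC, hw3, hvw⟩ := hw b' hbS' hb'
      exact absurd hvC (hX (a, b, v, w) ⟨Or.inr ⟨⟨ha, nH haS⟩, ⟨hv, nCH hvC⟩, ⟨hb, nH hbS⟩,
        hw3, nCH hwC⟩, hab, hvw, lt_oi hσ₂ (hz₂ a' haS' ha') ha haS hlt,
        lt_io hσ₃ (hz₃ b' hbS' hb') hb hbS hlt'⟩).2.2.1
    · have hbS' : b' ∉ C ∪ H := fun h => haS' (hS_adj h hab'.symm (ne2 ha'))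
      have hbS : b ∉ C ∪ H := fun h => haS (hS_adj h hab.symm (ne2 ha))
      exact ⟨Or.inr ⟨⟨ha, nH haS⟩, ⟨ha', nH haS'⟩, ⟨hb, nH hbS⟩, hb', nH hbS'⟩, hab, hab',
        lt_oo hσ₂ ha ha' haS haS' hlt, lt_oo hσ₃ hb' hb hbS' hbS hlt'⟩

/-- Deleting one of at least `2k + 2` nice connected components of `G - u` preserves
`k`-drawability. -/
theorem nice_component_reduction {V : Type*} [Fintype V] [DecidableEq V]
    (G : SimpleGraph V) (P₁ P₂ P₃ : Set V)
    (hcov : P₁ ∪ P₂ ∪ P₃ = Set.univ)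
    (h12 : Disjoint P₁ P₂) (h13 : Disjoint P₁ P₃) (h23 : Disjoint P₂ P₃)
    (hedge : ∀ a b : V, G.Adj a b →
      (a ∈ P₁ ∧ b ∈ P₂) ∨ (a ∈ P₂ ∧ b ∈ P₁) ∨ (a ∈ P₂ ∧ b ∈ P₃) ∨ (a ∈ P₃ ∧ b ∈ P₂))
    (k : ℕ) (u : V) (hu : u ∈ P₁)
    (hmany : 2 * k + 2 ≤ Set.ncard {c | NiceComponent G P₂ P₃ u c})
    (hadj : ∀ c : (G.induce {w | w ≠ u}).ConnectedComponent,
      NiceComponent G P₂ P₃ u c →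
      ∃ x, ∃ hx : x ≠ u,
        (G.induce {w | w ≠ u}).connectedComponentMk ⟨x, hx⟩ = c ∧ G.Adj u x)
    (c₀ : (G.induce {w | w ≠ u}).ConnectedComponent)
    (hc₀ : NiceComponent G P₂ P₃ u c₀)
    (hmin : (∃ c, NiceComponent G P₂ P₃ u c ∧ Set.ncard (compVerts G u c) = 1) →
      Set.ncard (compVerts G u c₀) = 1) :
    AdmitsDrawing G P₁ P₂ P₃ k ↔
      AdmitsDrawing G (P₁ \ compVerts G u c₀) (P₂ \ compVerts G u c₀)
        (P₃ \ compVerts G u c₀) k := by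
  refine ⟨fun h => h.diff _, ?_⟩
  rintro ⟨σ, ⟨hσ₁, hσ₂, hσ₃⟩, hσk⟩
  have hN : 2 * k < ({c | NiceComponent G P₂ P₃ u c} \ {c₀}).ncard := by
    rw [Set.ncard_sdiff_singleton_of_mem (show c₀ ∈ {c | NiceComponent G P₂ P₃ u c} from hc₀)]
    omega
  obtain ⟨c, ⟨hc, hcc₀⟩, hX⟩ := exists_compVerts_untouched hσk hN (fun q hq => ⟨hq.2.1, hq.2.2.1⟩)
  have two_of_adj : ∀ {x}, G.Adj u x → x ∈ P₂ := fun {x} hx => by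
    have n2 : u ∉ P₂ := fun h => h12.le_bot ⟨hu, h⟩
    have n3 : u ∉ P₃ := fun h => h13.le_bot ⟨hu, h⟩
    have := hedge u x hx
    tauto
  obtain ⟨v, hvu, hvc, huv⟩ := hadj c hc
  have hvC : v ∈ compVerts G u c := ⟨hvu, hvc⟩
  have hv := two_of_adj huv
  have hw : ∃ w, ∀ x ∈ compVerts G u c ∪ compVerts G u c₀, x ∈ P₃ →
      w ∈ compVerts G u c ∧ w ∈ P₃ ∧ G.Adj v w := by
    have not_three : ∀ {d : (G.induce {w | w ≠ u}).ConnectedComponent} {x y : V},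
        (compVerts G u d).ncard = 1 → y ∈ compVerts G u d → G.Adj u y →
        x ∈ compVerts G u d → x ∉ P₃ := by
      intro d x y hd hy huy hx hx3
      obtain ⟨z, hz⟩ := Set.ncard_eq_one.1 hd
      rw [hz] at hx hy
      obtain rfl : x = z := hx
      obtain rfl : y = x := hy
      exact h23.le_bot ⟨two_of_adj huy, hx3⟩
    by_cases h1 : (compVerts G u c).ncard = 1
    · obtain ⟨y, hyu, hyc, huy⟩ := hadj c₀ hc₀
      refine ⟨v, ?_⟩
      rintro x (hx | hx) hx3
      · exact absurd hx3 (not_three h1 hvC huv hx)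
      · exact absurd hx3 (not_three (hmin ⟨c, hc, h1⟩) ⟨hyu, hyc⟩ huy hx)
    · obtain ⟨w, hwC, hvw⟩ := exists_adj_of_ncard_compVerts_ne_one hvC h1
      refine ⟨w, fun _ _ _ => ⟨hwC, (hc.1 hwC).resolve_left fun hw2 => ?_, hvw⟩⟩
      have n1 : v ∉ P₁ := fun h => h12.le_bot ⟨h, hv⟩
      have n3 : v ∉ P₃ := fun h => h23.le_bot ⟨hv, h⟩
      have n1' : w ∉ P₁ := fun h => h12.le_bot ⟨h, hw2⟩
      have n3' : w ∉ P₃ := fun h => h23.le_bot ⟨hw2, h⟩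
      have := hedge v w hvw
      tauto
  obtain ⟨w, hw⟩ := hw
  obtain ⟨τC, hτC⟩ := hc.2
  obtain ⟨τH, hτH⟩ := hc₀.2
  obtain ⟨ρ, hρ, hsub⟩ := exists_drawing_crossings_subset h12 h13 h23 hu
    (Set.disjoint_left.2 fun x hx hx' => hcc₀ (eq_of_mem_compVerts hx hx')) hc.1 hc₀.1
    (fun _ _ ha hab hb => mem_compVerts_of_adj ha hab hb)
    (fun _ _ ha hab hb => mem_compVerts_of_adj ha hab hb)
    hτC hτH hvC hv huv hw hσ₁ hσ₂ hσ₃ hX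
  exact ⟨ρ, hρ, le_trans (Set.ncard_le_ncard hsub (Set.toFinite _)) hσk⟩
end

section
/- Let G be a 3-partite graph with vertex partition (V₁,V₂,V₃) in which every edge joins V₁ to V₂ or V₂ to V₃, let k be a natural number, and let σ be a 3-layer drawing of G respecting (V₁,V₂,V₃) with at most k crossings. Let D be the set of all vertices that are endpoints of edges involved in at least one crossing of σ. Suppose that for every u ∈ V₂ and every i ∈ {1,3}, the number of degree-one vertices of Vᵢ adjacent to u is at most k+1. Then for every u ∈ V₂ and every i ∈ {1,3}, the number of neighbours of u lying in Vᵢ ∖ D is at most k+3. -/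
/-- The edges `ab` and `a'b'` (oriented from the lower to the upper layer) form a
crossing pair in the drawing `σ`. -/
def CrossConfig {V : Type*} (G : SimpleGraph V) (P₁ P₂ P₃ : Set V) (σ : V → ℝ)
    (a b a' b' : V) : Prop :=
  ((a ∈ P₁ ∧ a' ∈ P₁ ∧ b ∈ P₂ ∧ b' ∈ P₂) ∨ (a ∈ P₂ ∧ a' ∈ P₂ ∧ b ∈ P₃ ∧ b' ∈ P₃)) ∧
    G.Adj a b ∧ G.Adj a' b' ∧ σ a < σ a' ∧ σ b' < σ b

/-- The set of endpoints of edges involved in at least one crossing of the drawing `σ`. -/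
def crossedVerts {V : Type*} (G : SimpleGraph V) (P₁ P₂ P₃ : Set V) (σ : V → ℝ) :
    Set V :=
  {x | ∃ a b a' b', CrossConfig G P₁ P₂ P₃ σ a b a' b' ∧
    (x = a ∨ x = b ∨ x = a' ∨ x = b')}

/-- A finite set with an injective real labelling in which no element lies strictly between
two others has at most two elements. -/
theorem Set.ncard_le_two_of_no_between {V : Type*} {S : Set V} (hS : S.Finite) {f : V → ℝ}
    (hf : Set.InjOn f S)
    (h : ∀ x ∈ S, ∀ y ∈ S, ∀ z ∈ S, f x < f y → f y < f z → False) : S.ncard ≤ 2 := by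
  by_contra! hlt
  obtain ⟨a, b, c, ha, hb, hc, hab, hac, hbc⟩ := (Set.two_lt_ncard_iff hS).1 hlt
  have hab' := hf.ne ha hb hab
  have hac' := hf.ne ha hc hac
  have hbc' := hf.ne hb hc hbc
  rcases lt_or_gt_of_ne hab' with h1 | h1 <;> rcases lt_or_gt_of_ne hac' with h2 | h2 <;>
    rcases lt_or_gt_of_ne hbc' with h3 | h3
  · exact h a ha b hb c hc h1 h3
  · exact h a ha c hc b hb h2 h3
  · linarith
  · exact h c hc a ha b hb h2 h1
  · exact h b hb a ha c hc h1 h2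
  · linarith
  · exact h b hb c hc a ha h3 h2
  · exact h c hc b hb a ha h3 h1

/-- If every `y ∈ P` with an edge crossing an edge at `u ∈ Q` lies in `D`, then
the number of neighbours of `u` in `P \ D` exceeds the number of pendant neighbours in `P` by at most two. -/
theorem SimpleGraph.ncard_neighbors_notMem_le {V : Type*} [Finite V] (G : SimpleGraph V)
    {P Q D : Set V} {σ : V → ℝ} (hP : Set.InjOn σ P) (hQ : Set.InjOn σ Q)
    (hPQ : ∀ w ∈ P, ∀ v, G.Adj w v → v ∈ Q) {u : V} (hu : u ∈ Q)
    (hleft : ∀ x ∈ P, ∀ y ∈ P, ∀ u' ∈ Q, G.Adj u x → G.Adj u' y →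
      σ x < σ y → σ u' < σ u → y ∈ D)
    (hright : ∀ y ∈ P, ∀ z ∈ P, ∀ u' ∈ Q, G.Adj u z → G.Adj u' y →
      σ y < σ z → σ u < σ u' → y ∈ D) :
    Set.ncard {w : V | w ∈ P ∧ w ∉ D ∧ G.Adj u w} ≤
      Set.ncard {w : V | w ∈ P ∧ G.neighborSet w = {u}} + 2 := by
  set A := {w : V | w ∈ P ∧ w ∉ D ∧ G.Adj u w}
  set B := {w : V | w ∈ P ∧ G.neighborSet w = {u}}
  have hAB : (A \ B).ncard ≤ 2 := by
    refine Set.ncard_le_two_of_no_between (Set.toFinite _) (hP.mono fun w hw => hw.1.1) ?_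
    rintro x ⟨⟨hx, -, hux⟩, -⟩ y ⟨⟨hy, hyD, huy⟩, hyB⟩ z ⟨⟨hz, -, huz⟩, -⟩ hxy hyz
    refine hyB ⟨hy, Set.Subset.antisymm (fun u' hu' => ?_) ?_⟩
    · have hyu' : G.Adj y u' := hu'
      have hu'Q := hPQ y hy u' hyu'
      by_contra hne
      rcases lt_or_gt_of_ne (hQ.ne hu'Q hu hne) with hlt | hlt
      · exact hyD (hleft x hx y hy u' hu'Q hux hyu'.symm hxy hlt)
      · exact hyD (hright y hy z hz u' hu'Q huz hyu'.symm hyz hlt)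
    · rintro _ rfl
      exact huy.symm
  have := Set.ncard_le_ncard_sdiff_add_ncard A B (Set.toFinite _)
  omega

/-- If no middle-layer vertex has more than `k + 1` pendant neighbours in an outer
layer, then in any drawing with at most `k` crossings, every middle-layer vertex has at
most `k + 3` neighbours in each outer layer avoiding the endpoints of crossing edges. -/
theorem few_uncrossed_neighbours {V : Type*} [Fintype V] [DecidableEq V]
    (G : SimpleGraph V) (P₁ P₂ P₃ : Set V)
    (hcov : P₁ ∪ P₂ ∪ P₃ = Set.univ)
    (h12 : Disjoint P₁ P₂) (h13 : Disjoint P₁ P₃) (h23 : Disjoint P₂ P₃)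
    (hedge : ∀ a b : V, G.Adj a b →
      (a ∈ P₁ ∧ b ∈ P₂) ∨ (a ∈ P₂ ∧ b ∈ P₁) ∨ (a ∈ P₂ ∧ b ∈ P₃) ∨ (a ∈ P₃ ∧ b ∈ P₂))
    (k : ℕ) (σ : V → ℝ)
    (hσ : Set.InjOn σ P₁ ∧ Set.InjOn σ P₂ ∧ Set.InjOn σ P₃)
    (hcr : crossNum3 G P₁ P₂ P₃ σ ≤ k)
    (hpend : ∀ u ∈ P₂,
      Set.ncard {w : V | w ∈ P₁ ∧ G.neighborSet w = {u}} ≤ k + 1 ∧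
      Set.ncard {w : V | w ∈ P₃ ∧ G.neighborSet w = {u}} ≤ k + 1) :
    ∀ u ∈ P₂,
      Set.ncard {w : V | w ∈ P₁ ∧ w ∉ crossedVerts G P₁ P₂ P₃ σ ∧ G.Adj u w} ≤ k + 3 ∧
      Set.ncard {w : V | w ∈ P₃ ∧ w ∉ crossedVerts G P₁ P₂ P₃ σ ∧ G.Adj u w} ≤ k + 3 := by
  intro u hu
  have hd12 := Set.disjoint_left.1 h12
  have hd13 := Set.disjoint_left.1 h13
  have hd23 := Set.disjoint_left.1 h23
  constructor
  · refine (G.ncard_neighbors_notMem_le hσ.1 hσ.2.1 ?_ hu ?_ ?_).trans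
      (Nat.add_le_add_right (hpend u hu).1 2)
    · intro w hw v hwv
      have := hedge w v hwv
      have := @hd12 w hw
      have := @hd13 w hw
      tauto
    · intro x hx y hy u' hu' hux huy hxy hlt
      exact ⟨x, u, y, u', ⟨.inl ⟨hx, hy, hu, hu'⟩, hux.symm, huy.symm, hxy, hlt⟩, by simp⟩
    · intro y hy z hz u' hu' huz huy hyz hlt
      exact ⟨y, u', z, u, ⟨.inl ⟨hy, hz, hu', hu⟩, huy.symm, huz.symm, hyz, hlt⟩, by simp⟩
  · refine (G.ncard_neighbors_notMem_le hσ.2.2 hσ.2.1 ?_ hu ?_ ?_).trans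
      (Nat.add_le_add_right (hpend u hu).2 2)
    · intro w hw v hwv
      have := hedge w v hwv
      have : w ∉ P₁ := fun h => hd13 h hw
      have : w ∉ P₂ := fun h => hd23 h hw
      tauto
    · intro x hx y hy u' hu' hux huy hxy hlt
      exact ⟨u', y, u, x, ⟨.inr ⟨hu', hu, hy, hx⟩, huy, hux, hlt, hxy⟩, by simp⟩
    · intro y hy z hz u' hu' huz huy hyz hlt
      exact ⟨u, z, u', y, ⟨.inr ⟨hu, hu', hz, hy⟩, huz, huy, hlt, hyz⟩, by simp⟩
end

section
/- For every natural number k ≥ 1, setting ℓ = ⌈log₂ k⌉ + 1, there exists an injective function c : Fin k → (Fin (2ℓ) → Bool) such that for every i the string c(i) takes the value true in exactly ℓ of its 2ℓ coordinates, and for all i and j the reversal of c(i) is distinct from c(j), where the reversal of a string s : Fin (2ℓ) → Bool is the string whose p-th coordinate is the (2ℓ−1−p)-th coordinate of s. -/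
/-- A binary string of even length whose reversal is its complement is balanced. -/
theorem card_filter_true_of_rev_eq_not {l : ℕ} {s : Fin (2 * l) → Bool}
    (hs : ∀ p, s p.rev = !s p) : (Finset.univ.filter (fun p => s p = true)).card = l := by
  have hrev : (Finset.univ.filter (fun p => s p = true)).card =
      (Finset.univ.filter (fun p => ¬ s p = true)).card :=
    Finset.card_equiv Fin.revPerm (by simp [hs])
  have hadd := Finset.card_filter_add_card_filter_not
    (s := (Finset.univ : Finset (Fin (2 * l)))) (fun p => s p = true)
  rw [Finset.card_univ, Fintype.card_fin] at hadd
  omega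

/-- The string of length `2 * l` starting with the first `l` values of `g` and continued so
that its reversal is its complement. -/
def antipalindrome (l : ℕ) (g : ℕ → Bool) (p : Fin (2 * l)) : Bool :=
  if (p : ℕ) < l then g p else !g p.rev

theorem antipalindrome_of_lt {l : ℕ} (g : ℕ → Bool) {p : Fin (2 * l)} (hp : (p : ℕ) < l) :
    antipalindrome l g p = g p :=
  if_pos hp

theorem antipalindrome_rev (l : ℕ) (g : ℕ → Bool) (p : Fin (2 * l)) :
    antipalindrome l g p.rev = !antipalindrome l g p := by
  have h := Fin.val_rev p
  by_cases hp : (p : ℕ) < l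
  · have hr : ¬ (p.rev : ℕ) < l := by omega
    simp only [antipalindrome, if_pos hp, if_neg hr, Fin.rev_rev]
  · have hr : (p.rev : ℕ) < l := by omega
    simp only [antipalindrome, if_neg hp, if_pos hr, Bool.not_not]

/-- The bit `true` followed by the binary digits of `n`, least significant first. -/
def trueThenBits (n : ℕ) : ℕ → Bool
  | 0 => true
  | m + 1 => n.testBit m

/-- For every `k ≥ 1` and `ℓ = ⌈log₂ k⌉ + 1`, the symbols of a `k`-letter alphabet can
be injectively encoded by balanced binary strings of length `2ℓ` so that no reversal of
a code word equals a code word. -/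
theorem balanced_reversal_free_encoding (k : ℕ) (hk : 1 ≤ k) :
    ∃ c : Fin k → (Fin (2 * (Nat.clog 2 k + 1)) → Bool),
      Function.Injective c ∧
      (∀ i, (Finset.univ.filter (fun p => c i p = true)).card = Nat.clog 2 k + 1) ∧
      (∀ i j, (fun p => c i p.rev) ≠ c j) := by
  refine ⟨fun i => antipalindrome _ (trueThenBits i), fun i j hij => ?_,
    fun i => card_filter_true_of_rev_eq_not (antipalindrome_rev _ _), fun i j hij => ?_⟩
  · have hpow : k ≤ 2 ^ Nat.clog 2 k := Nat.le_pow_clog one_lt_two k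
    refine Fin.ext (Nat.eq_of_testBit_eq fun m => ?_)
    by_cases hm : m < Nat.clog 2 k
    · have h := congrFun hij ⟨m + 1, by omega⟩
      beta_reduce at h
      rwa [antipalindrome_of_lt _ (Nat.succ_lt_succ hm),
        antipalindrome_of_lt _ (Nat.succ_lt_succ hm)] at h
    · have hle : 2 ^ Nat.clog 2 k ≤ 2 ^ m := Nat.pow_le_pow_right two_pos (not_lt.mp hm)
      rw [Nat.testBit_lt_two_pow (i.isLt.trans_le (hpow.trans hle)),
        Nat.testBit_lt_two_pow (j.isLt.trans_le (hpow.trans hle))]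
  · have h := congrFun hij ⟨0, by omega⟩
    beta_reduce at h
    rw [antipalindrome_rev, antipalindrome_of_lt _ (Nat.succ_pos _),
      antipalindrome_of_lt _ (Nat.succ_pos _)] at h
    exact Bool.false_ne_true h
end

section
/- Let G be a 3-partite graph with vertex partition (V₁,V₂,V₃) in which every edge joins V₁ to V₂ or V₂ to V₃, and let σ be a 3-layer drawing of G respecting (V₁,V₂,V₃) whose number of crossings is minimum among all 3-layer drawings of G respecting (V₁,V₂,V₃). Let p ≥ 1 be a natural number, let v be a vertex of G, let V_j be a part adjacent to the part containing v, and let U ⊆ V_j be a set of at least p degree-one vertices each of whose unique neighbour is v. If the number of crossings of σ is at most p − 1, then for every u ∈ U the edge uv crosses no edge in σ. -/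
/-- On a finite type, a real-valued function omits a right-hand neighbourhood of each point. -/
theorem exists_gt_forall_le_or_lt {V : Type*} [Finite V] (σ : V → ℝ) (c : ℝ) :
    ∃ t, c < t ∧ ∀ x, σ x ≤ c ∨ t < σ x := by
  have h : ∀ᶠ t in nhdsWithin c (Set.Ioi c), ∀ x, σ x ≤ c ∨ t < σ x := by
    rw [Filter.eventually_all]
    intro x
    rcases le_or_gt (σ x) c with hx | hx
    · exact Filter.Eventually.of_forall fun _ => Or.inl hx
    · filter_upwards [mem_nhdsWithin_of_mem_nhds (Iio_mem_nhds hx)] with t ht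
      exact Or.inr ht
  obtain ⟨t, ht, htc⟩ := (h.and self_mem_nhdsWithin).exists
  exact ⟨t, htc, ht⟩

/-- The edge quadruples counted by `crossNum3`. -/
def crossSet {V : Type*} (G : SimpleGraph V) (P₁ P₂ P₃ : Set V) (σ : V → ℝ) :
    Set (V × V × V × V) :=
  {q | CrossConfig G P₁ P₂ P₃ σ q.1 q.2.1 q.2.2.1 q.2.2.2}

theorem crossNum3_eq_ncard_crossSet {V : Type*} (G : SimpleGraph V) (P₁ P₂ P₃ : Set V)
    (σ : V → ℝ) : crossNum3 G P₁ P₂ P₃ σ = (crossSet G P₁ P₂ P₃ σ).ncard := rfl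

/-- The vertex `x` is an endpoint of one of the two edges `ab` and `a'b'` recorded by `q`. -/
def IsEndpoint {V : Type*} (x : V) (q : V × V × V × V) : Prop :=
  x = q.1 ∨ x = q.2.1 ∨ x = q.2.2.1 ∨ x = q.2.2.2

/-- Two distinct pendant vertices with the same neighbour are not involved in a common crossing. -/
theorem eq_of_isEndpoint_of_mem_crossSet {V : Type*} {G : SimpleGraph V} {P₁ P₂ P₃ : Set V}
    {σ : V → ℝ} (hindep : ∀ a b, G.Adj a b →
      ¬ (a ∈ P₁ ∧ b ∈ P₁) ∧ ¬ (a ∈ P₂ ∧ b ∈ P₂) ∧ ¬ (a ∈ P₃ ∧ b ∈ P₃))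
    {v x y : V} (hx : ∀ w, G.Adj x w ↔ w = v) (hy : ∀ w, G.Adj y w ↔ w = v)
    {q : V × V × V × V} (hq : q ∈ crossSet G P₁ P₂ P₃ σ)
    (hxq : IsEndpoint x q) (hyq : IsEndpoint y q) : x = y := by
  obtain ⟨a, b, a', b'⟩ := q
  obtain ⟨hP, hab, hab', h1, h2⟩ := hq
  simp only [IsEndpoint] at hxq hyq hP hab hab' h1 h2
  have hxv := (hx v).2 rfl
  have hyv := (hy v).2 rfl
  have hi := hindep x v hxv
  have hj := hindep y v hyv
  have hne := hxv.ne
  have hne' := hyv.ne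
  have hba := hab.symm
  have hba' := hab'.symm
  by_contra hxy
  rcases hxq with rfl | rfl | rfl | rfl <;> rcases hyq with rfl | rfl | rfl | rfl <;>
    simp_all <;> tauto

/-- Moving a pendant vertex `u` immediately next to an uncrossed pendant vertex `w` with the same
neighbour creates no crossing. -/
theorem mem_crossSet_of_mem_crossSet_update {V : Type*} [DecidableEq V] {G : SimpleGraph V}
    {P₁ P₂ P₃ : Set V} {σ : V → ℝ}
    (hσ : Set.InjOn σ P₁ ∧ Set.InjOn σ P₂ ∧ Set.InjOn σ P₃)
    (hindep : ∀ a b, G.Adj a b →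
      ¬ (a ∈ P₁ ∧ b ∈ P₁) ∧ ¬ (a ∈ P₂ ∧ b ∈ P₂) ∧ ¬ (a ∈ P₃ ∧ b ∈ P₃))
    {v u w : V} (hu : ∀ x, G.Adj u x ↔ x = v) (hw : ∀ x, G.Adj w x ↔ x = v)
    (hpart : (u ∈ P₁ → w ∈ P₁) ∧ (u ∈ P₂ → w ∈ P₂) ∧ (u ∈ P₃ → w ∈ P₃))
    (hfree : ∀ q ∈ crossSet G P₁ P₂ P₃ σ, ¬ IsEndpoint w q)
    {t : ℝ} (hwt : σ w < t) (ht : ∀ x, σ x ≤ σ w ∨ t < σ x)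
    {q : V × V × V × V} (hq : q ∈ crossSet G P₁ P₂ P₃ (Function.update σ u t)) :
    q ∈ crossSet G P₁ P₂ P₃ σ ∧ ¬ IsEndpoint u q := by
  have huv := (hu v).2 rfl
  have hwv := (hw v).2 rfl
  have hi := hindep _ _ huv
  have hlt : ∀ x, t < σ x → σ w < σ x := fun x hx => hwt.trans hx
  have hgt : ∀ x, x ≠ w → ((u ∈ P₁ ∧ x ∈ P₁) ∨ (u ∈ P₂ ∧ x ∈ P₂) ∨ (u ∈ P₃ ∧ x ∈ P₃)) →
      σ x < t → σ x < σ w := by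
    intro x hxw hP hx
    refine lt_of_le_of_ne ((ht x).resolve_right hx.not_gt) fun h => hxw ?_
    rcases hP with ⟨h1, h2⟩ | ⟨h1, h2⟩ | ⟨h1, h2⟩
    · exact hσ.1 h2 (hpart.1 h1) h
    · exact hσ.2.1 h2 (hpart.2.1 h1) h
    · exact hσ.2.2 h2 (hpart.2.2 h1) h
  have huend : ¬ IsEndpoint u q := by
    obtain ⟨a, b, a', b'⟩ := q
    obtain ⟨hP, hab, hab', h1, h2⟩ := hq
    simp only at hP hab hab' h1 h2
    have hne := huv.ne'
    rintro (h | h | h | h) <;> simp only at h <;> subst h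
    · obtain rfl := (hu _).1 hab
      have ha' : a' ≠ u := by rintro rfl; exact lt_irrefl _ h1
      have hb' : b' ≠ u := by
        rintro rfl
        exact hP.elim (fun h => hi.2.1 ⟨h.2.2.2, h.2.2.1⟩) (fun h => hi.2.2 ⟨h.2.2.2, h.2.2.1⟩)
      rw [Function.update_self, Function.update_of_ne ha'] at h1
      rw [Function.update_of_ne hb', Function.update_of_ne hne] at h2
      exact hfree (w, b, a', b') ⟨hP.imp (fun h => ⟨hpart.1 h.1, h.2⟩)
        (fun h => ⟨hpart.2.1 h.1, h.2⟩), hwv, hab', hlt _ h1, h2⟩ (by simp [IsEndpoint])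
    · obtain rfl := (hu _).1 hab.symm
      have hb' : b' ≠ u := by rintro rfl; exact lt_irrefl _ h2
      have ha' : a' ≠ u := by
        rintro rfl
        exact hP.elim (fun h => hi.1 ⟨h.2.1, h.1⟩) (fun h => hi.2.1 ⟨h.2.1, h.1⟩)
      have hbw : b' ≠ w := by rintro rfl; rw [(hw _).1 hab'.symm] at h1; exact lt_irrefl _ h1
      rw [Function.update_self, Function.update_of_ne hb'] at h2
      rw [Function.update_of_ne ha', Function.update_of_ne hne] at h1
      exact hfree (a, w, a', b') ⟨hP.imp (fun h => ⟨h.1, h.2.1, hpart.2.1 h.2.2.1, h.2.2.2⟩)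
        (fun h => ⟨h.1, h.2.1, hpart.2.2 h.2.2.1, h.2.2.2⟩), hwv.symm, hab', h1, hgt _ hbw (hP.elim (fun h => .inr (.inl h.2.2))
          (fun h => .inr (.inr h.2.2))) h2⟩
        (by simp [IsEndpoint])
    · obtain rfl := (hu _).1 hab'
      have ha : a ≠ u := by rintro rfl; exact lt_irrefl _ h1
      have hb : b ≠ u := by
        rintro rfl
        exact hP.elim (fun h => hi.2.1 ⟨h.2.2.1, h.2.2.2⟩) (fun h => hi.2.2 ⟨h.2.2.1, h.2.2.2⟩)
      have haw : a ≠ w := by rintro rfl; rw [(hw _).1 hab] at h2; exact lt_irrefl _ h2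
      rw [Function.update_self, Function.update_of_ne ha] at h1
      rw [Function.update_of_ne hb, Function.update_of_ne hne] at h2
      exact hfree (a, b, w, b') ⟨hP.imp (fun h => ⟨h.1, hpart.1 h.2.1, h.2.2⟩)
        (fun h => ⟨h.1, hpart.2.1 h.2.1, h.2.2⟩), hab, hwv, hgt _ haw (hP.elim (fun h => .inl ⟨h.2.1, h.1⟩)
          (fun h => .inr (.inl ⟨h.2.1, h.1⟩))) h1, h2⟩
        (by simp [IsEndpoint])
    · obtain rfl := (hu _).1 hab'.symm
      have hb : b ≠ u := by rintro rfl; exact lt_irrefl _ h2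
      have ha : a ≠ u := by
        rintro rfl
        exact hP.elim (fun h => hi.1 ⟨h.1, h.2.1⟩) (fun h => hi.2.1 ⟨h.1, h.2.1⟩)
      rw [Function.update_self, Function.update_of_ne hb] at h2
      rw [Function.update_of_ne ha, Function.update_of_ne hne] at h1
      exact hfree (a, b, a', w) ⟨hP.imp (fun h => ⟨h.1, h.2.1, h.2.2.1, hpart.2.1 h.2.2.2⟩)
        (fun h => ⟨h.1, h.2.1, h.2.2.1, hpart.2.2 h.2.2.2⟩), hab, hwv.symm, h1, hlt _ h2⟩ (by simp [IsEndpoint])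
  refine ⟨?_, huend⟩
  obtain ⟨a, b, a', b'⟩ := q
  simp only [IsEndpoint, not_or] at huend
  obtain ⟨ha, hb, ha', hb'⟩ := huend
  simpa [crossSet, CrossConfig, Function.update_of_ne, Ne.symm ha, Ne.symm hb, Ne.symm ha',
    Ne.symm hb'] using hq

/-- In a crossing-minimum drawing with at most `p - 1` crossings, none of the `p`
pendant edges at `v` is crossed. -/
theorem pendant_edges_crossing_free {V : Type*} [Fintype V] [DecidableEq V]
    (G : SimpleGraph V) (P₁ P₂ P₃ : Set V)
    (hcov : P₁ ∪ P₂ ∪ P₃ = Set.univ)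
    (h12 : Disjoint P₁ P₂) (h13 : Disjoint P₁ P₃) (h23 : Disjoint P₂ P₃)
    (hedge : ∀ a b : V, G.Adj a b →
      (a ∈ P₁ ∧ b ∈ P₂) ∨ (a ∈ P₂ ∧ b ∈ P₁) ∨ (a ∈ P₂ ∧ b ∈ P₃) ∨ (a ∈ P₃ ∧ b ∈ P₂))
    (σ : V → ℝ)
    (hσ : Set.InjOn σ P₁ ∧ Set.InjOn σ P₂ ∧ Set.InjOn σ P₃)
    (hmin : ∀ τ : V → ℝ, (Set.InjOn τ P₁ ∧ Set.InjOn τ P₂ ∧ Set.InjOn τ P₃) →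
      crossNum3 G P₁ P₂ P₃ σ ≤ crossNum3 G P₁ P₂ P₃ τ)
    (p : ℕ) (hp : 1 ≤ p) (v : V) (U : Set V)
    (hUpart : (v ∈ P₁ ∧ U ⊆ P₂) ∨ (v ∈ P₂ ∧ U ⊆ P₁) ∨
      (v ∈ P₂ ∧ U ⊆ P₃) ∨ (v ∈ P₃ ∧ U ⊆ P₂))
    (hUcard : p ≤ Set.ncard U)
    (hUpend : ∀ u ∈ U, G.neighborSet u = {v})
    (hfew : crossNum3 G P₁ P₂ P₃ σ ≤ p - 1) :
    ∀ u ∈ U, ∀ a b : V,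
      ¬ CrossConfig G P₁ P₂ P₃ σ u v a b ∧ ¬ CrossConfig G P₁ P₂ P₃ σ v u a b ∧
      ¬ CrossConfig G P₁ P₂ P₃ σ a b u v ∧ ¬ CrossConfig G P₁ P₂ P₃ σ a b v u := by
  have hindep : ∀ a b, G.Adj a b →
      ¬ (a ∈ P₁ ∧ b ∈ P₁) ∧ ¬ (a ∈ P₂ ∧ b ∈ P₂) ∧ ¬ (a ∈ P₃ ∧ b ∈ P₃) := by
    intro a b hab
    have := hedge a b hab
    rw [Set.disjoint_left] at h12 h13 h23
    grind
  have hpend : ∀ u ∈ U, ∀ x, G.Adj u x ↔ x = v := fun u hu x => by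
    rw [← SimpleGraph.mem_neighborSet, hUpend u hu, Set.mem_singleton_iff]
  obtain ⟨w, hwU, hfree⟩ : ∃ w ∈ U, ∀ q ∈ crossSet G P₁ P₂ P₃ σ, ¬ IsEndpoint w q := by
    by_contra! hcon
    choose! f hf hfend using hcon
    have hle : U.ncard ≤ (crossSet G P₁ P₂ P₃ σ).ncard :=
      Set.ncard_le_ncard_of_injOn f hf (fun x hx y hy hxy =>
        eq_of_isEndpoint_of_mem_crossSet hindep (hpend x hx) (hpend y hy) (hf x hx)
          (hfend x hx) (hxy ▸ hfend y hy)) (Set.toFinite _)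
    rw [← crossNum3_eq_ncard_crossSet] at hle
    omega
  intro u huU
  have key : ∀ q ∈ crossSet G P₁ P₂ P₃ σ, ¬ IsEndpoint u q := by
    intro q hq huq
    obtain ⟨t, hwt, ht⟩ := exists_gt_forall_le_or_lt σ (σ w)
    have hpart : (u ∈ P₁ → w ∈ P₁) ∧ (u ∈ P₂ → w ∈ P₂) ∧ (u ∈ P₃ → w ∈ P₃) := by
      rw [Set.disjoint_left] at h12 h13 h23
      grind
    have hinj : ∀ P : Set V, Set.InjOn σ P → Set.InjOn (Function.update σ u t) P := by
      intro P hP x hx y hy hxy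
      have hσt : ∀ z, σ z ≠ t := fun z hz => by
        rcases ht z with h | h <;> linarith
      simp only [Function.update_apply] at hxy
      split_ifs at hxy with h1 h2 h2
      · rw [h1, h2]
      · exact absurd hxy.symm (hσt y)
      · exact absurd hxy (hσt x)
      · exact hP hx hy hxy
    have hstep := fun r => mem_crossSet_of_mem_crossSet_update hσ hindep (hpend u huU) (hpend w hwU)
      hpart hfree hwt ht (q := r)
    refine (hmin _ ⟨hinj _ hσ.1, hinj _ hσ.2.1, hinj _ hσ.2.2⟩).not_gt ?_
    rw [crossNum3_eq_ncard_crossSet, crossNum3_eq_ncard_crossSet]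
    refine Set.ncard_lt_ncard ?_ (Set.toFinite _)
    exact ⟨fun r hr => (hstep r hr).1, fun h => (hstep q (h hq)).2 huq⟩
  intro a b
  refine ⟨fun h => key (u, v, a, b) h ?_, fun h => key (v, u, a, b) h ?_,
    fun h => key (a, b, u, v) h ?_, fun h => key (a, b, v, u) h ?_⟩ <;> simp [IsEndpoint]
end
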